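/- Let W be a 2-dimensional Coxeter group. Let g, g' ∈ W be such that g' ∈ g⟨s,t⟩ for some s, t ∈ S with m_st < ∞ (possibly s = t). Then there exist integers 0 ≤ k, k' ≤ 3 with k + k' > 0 such that Π^{k'}(g') ∈ Π^{k}(g)⟨p,r⟩ for some p, r ∈ S with m_pr < ∞ (possibly p = r). -/

import Mathlib

namespace CoxeterPaper

open CoxeterSystem

attribute [local instance] Classical.propDecidable

variable {B : Type} [DecidableEq B] [Fintype B]
variable {W : Type} [Group W] {M : CoxeterMatrix B}

/-- The right descent set `T(g) = {s ∈ S : ℓ(gs) < ℓ(g)}`, as a set of indices. -/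
def descentSet (cs : CoxeterSystem M W) (g : W) : Set B :=
  {i | cs.IsRightDescent g i}

/-- The subgroup `⟨T(g)⟩` generated by the right descent set of `g`. -/
def descSubgroup (cs : CoxeterSystem M W) (g : W) : Subgroup W :=
  Subgroup.closure (cs.simple '' descentSet cs g)

/-- `w(g)`: the longest element of `⟨T(g)⟩` (defined via choice; for `g ≠ 1` the
subgroup `⟨T(g)⟩` is finite and has a unique longest element). -/
noncomputable def wg (cs : CoxeterSystem M W) (g : W) : W :=
  if h : ∃ w₀ ∈ descSubgroup cs g, ∀ u ∈ descSubgroup cs g, cs.length u ≤ cs.length w₀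
  then h.choose else 1

/-- `Π(g) = g · w(g)`. -/
noncomputable def PiMap (cs : CoxeterSystem M W) (g : W) : W := g * wg cs g

/-- The standard language `𝓛 ⊆ S*`: the empty word is in `𝓛` (and it is the only word of `𝓛`
representing the identity); a word `v` of length `n` representing `g ≠ 1` is in `𝓛` iff,
setting `k = ℓ(w(g))`, the prefix `v(n-k)` is in `𝓛` and `v(n-k+1, n)` represents `w(g)`. -/
inductive StdLang (cs : CoxeterSystem M W) : List B → Prop
  | nil : StdLang cs []
  | step (v : List B) (hne : cs.wordProd v ≠ 1)
      (hpre : StdLang cs (v.take (v.length - cs.length (wg cs (cs.wordProd v)))))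
      (hsuf : cs.wordProd (v.drop (v.length - cs.length (wg cs (cs.wordProd v))))
        = wg cs (cs.wordProd v)) : StdLang cs v

/-- A Coxeter group is 2-dimensional if every triple of distinct generators
generates an infinite subgroup. -/
def TwoDimensional (cs : CoxeterSystem M W) : Prop :=
  ∀ i j k : B, i ≠ j → i ≠ k → j ≠ k →
    Infinite (Subgroup.closure {cs.simple i, cs.simple j, cs.simple k} : Subgroup W)

/-- The wall of the reflection `ρ` separates `g` and `h`. -/
def Separates (cs : CoxeterSystem M W) (ρ g h : W) : Prop :=
  Xor' (cs.length (ρ * g) < cs.length g) (cs.length (ρ * h) < cs.length h)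

/-- `h` is adjacent to the wall of the reflection `ρ`. -/
def AdjacentWall (cs : CoxeterSystem M W) (ρ h : W) : Prop :=
  ∃ i : B, ρ = h * cs.simple i * h⁻¹

/-- The wall of `ρ'` separates `g` from the wall of `ρ`. -/
def SeparatesFromWall (cs : CoxeterSystem M W) (ρ' g ρ : W) : Prop :=
  ∀ h : W, AdjacentWall cs ρ h → Separates cs ρ' g h

/-- `𝓦(g)`: the set of walls (identified with their reflections) separating `g` from the
identity and not separated from `g` by any other wall. -/
def WallsNear (cs : CoxeterSystem M W) (g : W) : Set W :=
  {ρ | cs.IsReflection ρ ∧ cs.length (ρ * g) < cs.length g ∧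
    ∀ ρ' : W, cs.IsReflection ρ' → ρ' ≠ ρ → ¬ SeparatesFromWall cs ρ' g ρ}

end CoxeterPaper

namespace CoxeterPaper

open CoxeterSystem

attribute [local instance] Classical.propDecidable

variable {B : Type} {W : Type} [Group W] {M : CoxeterMatrix B}

section Exchange

variable (cs : CoxeterSystem M W)

/-- The sign action of a simple reflection on pairs (group element, sign). -/
noncomputable def signAct (i : B) : Function.End (W × ZMod 2) := fun x =>
  (cs.simple i * x.1 * cs.simple i, x.2 + if x.1 = cs.simple i then 1 else 0)

theorem signAct_pow (i j : B) (k : ℕ) (x : W × ZMod 2) :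
    ((signAct cs i * signAct cs j) ^ k) x =
      ((cs.simple i * cs.simple j) ^ k * x.1 * ((cs.simple i * cs.simple j) ^ k)⁻¹,
        x.2 + ∑ l ∈ Finset.range (2 * k),
          if x.1 = cs.simple j * (cs.simple i * cs.simple j) ^ l then 1 else 0) := by
  induction k with
  | zero => exact Prod.ext (by simp; rfl) (by simp; rfl)
  | succ k ih =>
    have hj : (cs.simple j)⁻¹ = cs.simple j := cs.inv_simple j
    have hi : (cs.simple i)⁻¹ = cs.simple i := cs.inv_simple i
    set r := cs.simple i * cs.simple j with hr
    have hjr : ∀ n : ℕ, (r ^ n)⁻¹ * cs.simple j = cs.simple j * r ^ n := by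
      intro n
      have h1 : cs.simple j * r * (cs.simple j)⁻¹ = r⁻¹ := by
        simp [hr, mul_assoc, hi, hj]
      rw [← inv_pow, ← h1, conj_pow]
      simp [mul_assoc]
    have hmul : (signAct cs i * signAct cs j) ^ (k + 1) =
        (signAct cs i * signAct cs j) * (signAct cs i * signAct cs j) ^ k := pow_succ' _ _
    have e1 : ∀ t : W, (r ^ k * t * (r ^ k)⁻¹ = cs.simple j) ↔
        t = cs.simple j * r ^ (2 * k) := by
      intro t
      rw [two_mul, pow_add, ← mul_assoc, ← hjr]
      constructor
      · intro h; rw [← h]; group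
      · rintro rfl; group
    have e2 : ∀ t : W, (cs.simple j * (r ^ k * t * (r ^ k)⁻¹) * cs.simple j = cs.simple i) ↔
        t = cs.simple j * r ^ (2 * k + 1) := by
      intro t
      have h2 : cs.simple j * r ^ (2 * k + 1) = (r ^ k)⁻¹ * (cs.simple j * cs.simple i *
          cs.simple j) * r ^ k := by
        have : 2 * k + 1 = k + (1 + k) := by ring
        rw [this, pow_add, ← mul_assoc, ← hjr, pow_add, pow_one, hr]
        simp only [mul_assoc]
      rw [h2]
      constructor
      · intro h; rw [← h]
        have := cs.simple_mul_simple_self j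
        have h3 : cs.simple j * (cs.simple j * (r ^ k * t * (r ^ k)⁻¹) * cs.simple j) *
          cs.simple j = r ^ k * t * (r ^ k)⁻¹ := by
          simp [mul_assoc]
        rw [h3]; group
      · rintro rfl
        have h3 : r ^ k * ((r ^ k)⁻¹ * (cs.simple j * cs.simple i * cs.simple j) * r ^ k) *
          (r ^ k)⁻¹ = cs.simple j * cs.simple i * cs.simple j := by group
        rw [h3]; simp [mul_assoc]
    rw [hmul]
    change signAct cs i (signAct cs j (((signAct cs i * signAct cs j) ^ k) x)) = _
    rw [ih]
    unfold signAct
    ext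
    · simp only [pow_succ' r, mul_inv_rev]
      simp [hr, mul_assoc, hi, hj]
    · simp only [e1, e2]
      rw [show 2 * (k + 1) = 2 * k + 1 + 1 by ring, Finset.sum_range_succ, Finset.sum_range_succ]
      ring

theorem signAct_liftable : M.IsLiftable (signAct cs) := by
  intro i j
  have hr := cs.simple_mul_simple_pow i j
  funext x
  rw [signAct_pow, hr]
  have h0 : ∑ l ∈ Finset.range (2 * M i j),
      (if x.1 = cs.simple j * (cs.simple i * cs.simple j) ^ l then (1 : ZMod 2) else 0) = 0 := by
    rw [two_mul, Finset.sum_range_add]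
    simp only [pow_add, hr, one_mul]
    exact CharTwo.add_self_eq_zero _
  rw [h0]
  exact Prod.ext (by simp; rfl) (by simp; rfl)

/-- The sign action of the Coxeter group. -/
noncomputable def signHom : W →* Function.End (W × ZMod 2) :=
  cs.lift ⟨signAct cs, signAct_liftable cs⟩

theorem signHom_wordProd (ω : List B) (x : W × ZMod 2) :
    signHom cs (cs.wordProd ω) x =
      (cs.wordProd ω * x.1 * (cs.wordProd ω)⁻¹, x.2 + ((cs.rightInvSeq ω).count x.1 : ZMod 2)) := by
  induction ω with
  | nil => simp; rfl
  | cons i ω ih =>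
    rw [cs.wordProd_cons, map_mul]
    change signHom cs (cs.simple i) (signHom cs (cs.wordProd ω) x) = _
    rw [ih, signHom, cs.lift_apply_simple]
    unfold signAct
    ext
    · simp [mul_assoc]
    · simp only [rightInvSeq, List.count_cons, beq_iff_eq]
      have : (cs.wordProd ω * x.1 * (cs.wordProd ω)⁻¹ = cs.simple i) ↔
          ((cs.wordProd ω)⁻¹ * cs.simple i * cs.wordProd ω = x.1) := by
        constructor
        · intro h; rw [← h]; group
        · intro h; rw [← h]; group
      simp only [this]
      split_ifs <;> simp [add_assoc]

theorem count_rightInvSeq_congr {ω ω' : List B} (h : cs.wordProd ω = cs.wordProd ω') (t : W) :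
    ((cs.rightInvSeq ω).count t : ZMod 2) = ((cs.rightInvSeq ω').count t : ZMod 2) := by
  have h1 := signHom_wordProd cs ω (t, 0)
  rw [h, signHom_wordProd] at h1
  simpa using (congrArg Prod.snd h1).symm

theorem isReduced_of_nodup {ω : List B} (h : (cs.rightInvSeq ω).Nodup) : cs.IsReduced ω := by
  obtain ⟨ω', hω', e⟩ := cs.exists_isReduced (cs.wordProd ω)
  have hsub : cs.rightInvSeq ω ⊆ cs.rightInvSeq ω' := by
    intro t ht
    by_contra hn
    have h1 := count_rightInvSeq_congr cs e t
    rw [List.count_eq_one_of_mem h ht, List.count_eq_zero_of_not_mem hn] at h1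
    simp at h1
  have h2 := (List.subperm_of_subset h hsub).length_le
  rw [cs.length_rightInvSeq, cs.length_rightInvSeq] at h2
  have h3 : cs.length (cs.wordProd ω') = ω'.length := hω'
  have h4 := cs.length_wordProd_le ω
  unfold CoxeterSystem.IsReduced
  rw [e] at h4 ⊢
  omega

/-- The exchange condition. -/
theorem exists_eraseIdx {ω : List B} {i : B} (h : cs.IsRightDescent (cs.wordProd ω) i) :
    ∃ n < ω.length, cs.wordProd ω * cs.simple i = cs.wordProd (ω.eraseIdx n) := by
  obtain ⟨ω', hω', e⟩ := cs.exists_isReduced (cs.wordProd ω * cs.simple i)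
  have e1 : cs.wordProd ω = cs.wordProd (ω'.concat i) := by
    rw [cs.wordProd_concat, ← e]; simp
  have hred : cs.IsReduced (ω'.concat i) := by
    unfold CoxeterSystem.IsReduced at *
    rw [← e1, List.length_concat, ← hω', ← e]
    exact (cs.isRightDescent_iff.1 h).symm
  have hmem : cs.simple i ∈ cs.rightInvSeq (ω'.concat i) := by
    rw [cs.rightInvSeq_concat]; simp
  have hc := count_rightInvSeq_congr cs e1 (cs.simple i)
  rw [List.count_eq_one_of_mem hred.nodup_rightInvSeq hmem] at hc
  have hmem' : cs.simple i ∈ cs.rightInvSeq ω := by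
    by_contra hn
    rw [List.count_eq_zero_of_not_mem hn] at hc
    simp at hc
  obtain ⟨n, hn, hne⟩ := List.getElem_of_mem hmem'
  refine ⟨n, by simpa using hn, ?_⟩
  rw [← cs.wordProd_mul_getD_rightInvSeq, List.getD_eq_getElem _ _ hn, hne]

end Exchange

section Geometric

open Polynomial Polynomial.Chebyshev Real

/-- The coroots of the geometric representation. -/
noncomputable def coroot (M : CoxeterMatrix B) (i : B) : Module.Dual ℝ (B →₀ ℝ) :=
  Finsupp.linearCombination ℝ (fun j => -2 * cos (π / M i j))

theorem coroot_single (M : CoxeterMatrix B) (i j : B) :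
    coroot M i (Finsupp.single j 1) = -2 * cos (π / M i j) := by
  simp [coroot]

theorem coroot_self (M : CoxeterMatrix B) (i : B) : coroot M i (Finsupp.single i 1) = 2 := by
  simp [coroot_single]

theorem coroot_param (M : CoxeterMatrix B) (i j : B) :
    2 * cos (2 * π / M i j) =
      coroot M i (Finsupp.single j 1) * coroot M j (Finsupp.single i 1) - 2 := by
  rw [coroot_single, coroot_single, M.symmetric j i,
    show 2 * π / M i j = 2 * (π / M i j) by ring, cos_two_mul]
  ring

theorem S_eval_mul_sin (n : ℤ) (θ : ℝ) :
    (S ℝ n).eval (2 * cos θ) * sin θ = sin ((n + 1) * θ) := S_two_mul_real_cos θ n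

theorem sin_two_pi_div_pos {m : ℕ} (hm : 3 ≤ m) : 0 < sin (2 * π / m) := by
  have hm' : (3 : ℝ) ≤ m := by exact_mod_cast hm
  apply sin_pos_of_pos_of_lt_pi
  · have := pi_pos; positivity
  · rw [div_lt_iff₀ (by linarith)]
    nlinarith [pi_pos]

theorem reflection_liftable (M : CoxeterMatrix B) :
    M.IsLiftable (fun i => Module.reflection (coroot_self M i)) := by
  intro i j
  by_cases hij : i = j
  · subst hij
    ext1 z
    simp only [M.diagonal, pow_one, LinearEquiv.mul_apply, LinearEquiv.coe_one, id]
    exact Module.involutive_reflection _ z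
  rcases Nat.lt_or_ge (M i j) 3 with h3 | h3
  · have h1 : M i j ≠ 1 := M.off_diagonal i j hij
    have : M i j = 0 ∨ M i j = 2 := by omega
    rcases this with h0 | h2
    · rw [h0, pow_zero]
    · rw [h2]
      have e1 : coroot M i (Finsupp.single j 1) = 0 := by
        rw [coroot_single, h2]; simp
      have e2 : coroot M j (Finsupp.single i 1) = 0 := by
        rw [coroot_single, M.symmetric j i, h2]; simp
      ext1 z
      simp only [pow_two, LinearEquiv.mul_apply, Module.reflection_apply, map_sub, map_smul, e1, e2,
        coroot_self, LinearEquiv.coe_one, id]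
      module
  · have hs := sin_two_pi_div_pos h3
    have hm0 : (M i j : ℝ) ≠ 0 := by
      have : M i j ≠ 0 := by omega
      exact_mod_cast this
    ext1 z
    rw [Module.reflection_mul_reflection_pow_apply (coroot_self M i) (coroot_self M j) (M i j) z
      _ (coroot_param M i j)]
    set θ : ℝ := 2 * π / M i j with hθ
    have hMθ : (M i j : ℝ) * θ = 2 * π := by rw [hθ]; field_simp
    rcases Nat.even_or_odd' (M i j) with ⟨k, hk | hk⟩
    · have hz : (S ℝ ((k : ℤ) - 1)).eval (2 * cos θ) = 0 := by
        have := S_eval_mul_sin ((k : ℤ) - 1) θ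
        have e : (((k : ℤ) - 1 : ℤ) + 1 : ℝ) * θ = π := by
          rw [hk] at hMθ; push_cast at hMθ ⊢; linarith
        rw [e, sin_pi] at this
        exact (mul_eq_zero.1 this).resolve_right hs.ne'
      have a1 : ((M i j : ℤ) - 2) / 2 = (k : ℤ) - 1 := by omega
      have a2 : ((M i j : ℤ) - 1) / 2 = (k : ℤ) - 1 := by omega
      rw [a1, a2, hz]
      simp
    · have hz : (S ℝ (k : ℤ)).eval (2 * cos θ) + (S ℝ ((k : ℤ) - 1)).eval (2 * cos θ) = 0 := by
        have h1 := S_eval_mul_sin ((k : ℤ) - 1) θ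
        have h2 := S_eval_mul_sin (k : ℤ) θ
        have e : (((k : ℤ) : ℝ) + 1) * θ = 2 * π - (k : ℝ) * θ := by
          rw [hk] at hMθ; push_cast at hMθ ⊢; linarith
        rw [e, sin_two_pi_sub] at h2
        push_cast at h1
        rw [sub_add_cancel] at h1
        have : ((S ℝ (k : ℤ)).eval (2 * cos θ) + (S ℝ ((k : ℤ) - 1)).eval (2 * cos θ)) * sin θ
          = 0 := by rw [add_mul, h1, h2]; ring
        exact (mul_eq_zero.1 this).resolve_right hs.ne'
      have a1 : ((M i j : ℤ) - 1) / 2 = (k : ℤ) := by omega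
      have a2 : ((M i j : ℤ) - 3) / 2 = (k : ℤ) - 1 := by omega
      have a3 : ((M i j : ℤ)) / 2 = (k : ℤ) := by omega
      have a4 : ((M i j : ℤ) - 2) / 2 = (k : ℤ) - 1 := by omega
      rw [a1, a2, a3, a4, hz]
      simp

/-- The order of a product of two distinct simple reflections is the Coxeter matrix entry. -/
theorem le_of_simple_mul_simple_pow_eq_one (cs : CoxeterSystem M W) {i j : B} (hij : i ≠ j) {k : ℕ}
    (hk : 0 < k) (h : (cs.simple i * cs.simple j) ^ k = 1) : M i j ≠ 0 ∧ M i j ≤ k := by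
  have h1 := congrArg (cs.lift ⟨_, reflection_liftable M⟩) h
  rw [map_pow, map_mul, cs.lift_apply_simple, cs.lift_apply_simple, map_one] at h1
  have h2 := LinearEquiv.congr_fun h1 (Finsupp.single i 1)
  rw [Module.reflection_mul_reflection_pow_apply_self (coroot_self M i) (coroot_self M j) k _
    (coroot_param M i j)] at h2
  have hx := DFunLike.congr_fun h2 i
  have hy := DFunLike.congr_fun h2 j
  simp only [Finsupp.add_apply, Finsupp.smul_apply, Finsupp.single_eq_same, smul_eq_mul, mul_one,
    Finsupp.single_eq_of_ne hij, Finsupp.single_eq_of_ne hij.symm, LinearEquiv.coe_one, id,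
    mul_zero, add_zero, zero_add, coroot_single, M.symmetric j i] at hx hy
  have hM1 : M i j ≠ 1 := M.off_diagonal i j hij
  by_cases h0 : M i j = 0
  · rw [h0] at hy
    simp only [Nat.cast_zero, div_zero, cos_zero, mul_one] at hy
    rw [S_eval_two] at hy
    push_cast at hy
    have : (k : ℝ) ≠ 0 := by exact_mod_cast hk.ne'
    simp at hy
    omega
  refine ⟨h0, ?_⟩
  by_contra hlt
  push Not at hlt
  by_cases hM2 : M i j = 2
  · have hk1 : k = 1 := by omega
    subst hk1
    rw [hM2] at hx
    have : 2 * π / ((2 : ℕ) : ℝ) = π := by push_cast; ring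
    rw [this] at hx
    norm_num at hx
  · have h3 : 3 ≤ M i j := by omega
    have hs := sin_two_pi_div_pos h3
    have h3' : (3 : ℝ) ≤ M i j := by exact_mod_cast h3
    have hc : 0 < cos (π / M i j) := by
      apply cos_pos_of_mem_Ioo
      constructor
      · have := pi_pos
        have : 0 < π / M i j := by positivity
        linarith
      · rw [div_lt_iff₀ (by linarith)]
        nlinarith [pi_pos]
    set θ : ℝ := 2 * π / M i j with hθ
    have hz : (S ℝ ((k : ℤ) - 1)).eval (2 * cos θ) = 0 :=
      (mul_eq_zero.1 hy).resolve_right (by simp [hc.ne'])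
    rw [hz, add_zero] at hx
    have e1 := S_eval_mul_sin ((k : ℤ) - 1) θ
    have e2 := S_eval_mul_sin (k : ℤ) θ
    rw [hz, zero_mul] at e1
    push_cast at e1 e2
    rw [sub_add_cancel] at e1
    rw [hx, add_mul, sin_add, ← e1] at e2
    have hcos : cos (k * θ) = 1 := by
      have : (cos (k * θ) - 1) * sin θ = 0 := by
        simp only [one_mul, zero_mul, zero_add] at e2; linarith
      linarith [(mul_eq_zero.1 this).resolve_right hs.ne']
    have hMθ : (M i j : ℝ) * θ = 2 * π := by rw [hθ]; field_simp
    have hθp : 0 < θ := by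
      have := pi_pos
      rw [hθ]; positivity
    have hk' : (0 : ℝ) < k := by exact_mod_cast hk
    have hlt' : (k : ℝ) < M i j := by exact_mod_cast hlt
    have hpos : 0 < k * θ := by positivity
    have := (cos_eq_one_iff_of_lt_of_lt (by linarith [pi_pos]) (by nlinarith)).1 hcos
    linarith

end Geometric

section Dihedral

variable (cs : CoxeterSystem M W)

theorem rightInvSeq_alternatingWord (i j : B) (n : ℕ) :
    cs.rightInvSeq (alternatingWord i j n) =
      ((List.range n).map fun k => (cs.simple j * cs.simple i) ^ k * cs.simple j).reverse := by
  induction n with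
  | zero => simp [alternatingWord]
  | succ n ih =>
    rw [List.range_succ, List.map_append, List.reverse_append, ← ih, alternatingWord_succ']
    simp only [rightInvSeq, List.map_cons, List.map_nil, List.reverse_singleton,
      List.singleton_append, List.cons.injEq, and_true]
    have hinv : ∀ p : ℕ, ((cs.simple i * cs.simple j) ^ p)⁻¹ = (cs.simple j * cs.simple i) ^ p := by
      intro p; rw [← inv_pow, mul_inv_rev, cs.inv_simple, cs.inv_simple]
    have hcomm : ∀ p : ℕ, cs.simple j * (cs.simple i * cs.simple j) ^ p =
        (cs.simple j * cs.simple i) ^ p * cs.simple j := by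
      intro p
      induction p with
      | zero => simp
      | succ p ihp => rw [pow_succ, ← mul_assoc, ihp, pow_succ]; simp only [mul_assoc]
    rw [cs.prod_alternatingWord_eq_mul_pow]
    rcases Nat.even_or_odd' n with ⟨p, rfl | rfl⟩
    · rw [if_pos (by simp), if_pos (by simp), one_mul, show 2 * p / 2 = p by omega, hinv,
        mul_assoc, hcomm, two_mul, pow_add]
      simp only [mul_assoc]
    · rw [if_neg (by simp), if_neg (by simp), show (2 * p + 1) / 2 = p by omega, mul_inv_rev, hinv,
        cs.inv_simple, hcomm, show 2 * p + 1 = p + 1 + p by ring, pow_add, pow_add, pow_one]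
      simp only [mul_assoc]

theorem isReduced_alternatingWord {i j : B} (hij : i ≠ j) {n : ℕ} (hn : M i j = 0 ∨ n ≤ M i j) :
    cs.IsReduced (alternatingWord i j n) := by
  apply isReduced_of_nodup
  rw [rightInvSeq_alternatingWord, List.nodup_reverse]
  apply List.Nodup.map_on _ List.nodup_range
  have key : ∀ k l : ℕ, k < l → l < n → (cs.simple j * cs.simple i) ^ k * cs.simple j ≠
      (cs.simple j * cs.simple i) ^ l * cs.simple j := by
    intro k l hkl hl e
    have e' := mul_right_cancel e
    obtain ⟨d, rfl⟩ := Nat.exists_eq_add_of_lt hkl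
    rw [show k + d + 1 = k + (d + 1) by ring, pow_add] at e'
    have e'' : (cs.simple j * cs.simple i) ^ (d + 1) = 1 := by
      exact (mul_eq_left.1 e'.symm)
    have := le_of_simple_mul_simple_pow_eq_one cs hij.symm (Nat.succ_pos d) e''
    rw [M.symmetric j i] at this
    omega
  intro k hk l hl e
  rw [List.mem_range] at hk hl
  by_contra hne
  rcases Nat.lt_or_gt_of_ne hne with h | h
  · exact key k l h hl e
  · exact key l k h hk e.symm

end Dihedral

section Parabolic

variable (cs : CoxeterSystem M W)

/-- The standard parabolic subgroup generated by `J`. -/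
def parabolic (J : Set B) : Subgroup W := Subgroup.closure (cs.simple '' J)

variable {cs} {J : Set B}

theorem simple_mem_parabolic {j : B} (hj : j ∈ J) : cs.simple j ∈ parabolic cs J :=
  Subgroup.subset_closure ⟨j, hj, rfl⟩

theorem wordProd_mem_parabolic {ω : List B} (h : ∀ x ∈ ω, x ∈ J) :
    cs.wordProd ω ∈ parabolic cs J := by
  induction ω with
  | nil => rw [cs.wordProd_nil]; exact one_mem _
  | cons i ω ih =>
    rw [cs.wordProd_cons]
    exact mul_mem (simple_mem_parabolic (h i (by simp))) (ih fun x hx => h x (by simp [hx]))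

theorem exists_isReduced_mul_simple {ω : List B} (hJ : ∀ x ∈ ω, x ∈ J) (hω : cs.IsReduced ω)
    {j : B} (hj : j ∈ J) : ∃ ω' : List B, (∀ x ∈ ω', x ∈ J) ∧ cs.IsReduced ω' ∧
      cs.wordProd ω' = cs.wordProd ω * cs.simple j := by
  by_cases hd : cs.IsRightDescent (cs.wordProd ω) j
  · obtain ⟨n, hn, e⟩ := exists_eraseIdx cs hd
    refine ⟨ω.eraseIdx n, fun x hx => hJ x (List.mem_of_mem_eraseIdx hx), ?_, e.symm⟩
    have := cs.isRightDescent_iff.1 hd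
    unfold CoxeterSystem.IsReduced at *
    rw [← e, List.length_eraseIdx_of_lt hn]
    omega
  · refine ⟨ω.concat j, ?_, ?_, cs.wordProd_concat j ω⟩
    · intro x hx
      simp only [List.concat_eq_append, List.mem_append, List.mem_singleton] at hx
      rcases hx with hx | rfl
      · exact hJ x hx
      · exact hj
    · have := cs.not_isRightDescent_iff.1 hd
      unfold CoxeterSystem.IsReduced at *
      rw [cs.wordProd_concat, this, hω, List.length_concat]

theorem exists_isReduced_of_mem_parabolic {u : W} (hu : u ∈ parabolic cs J) :
    ∃ ω : List B, (∀ x ∈ ω, x ∈ J) ∧ cs.IsReduced ω ∧ cs.wordProd ω = u := by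
  induction hu using Subgroup.closure_induction_right with
  | one => exact ⟨[], by simp, by simp [CoxeterSystem.IsReduced], cs.wordProd_nil⟩
  | mul_right x hx y hy ih =>
    obtain ⟨ω, h1, h2, h3⟩ := ih
    obtain ⟨j, hj, rfl⟩ := hy
    rw [← h3]
    exact exists_isReduced_mul_simple h1 h2 hj
  | mul_inv_cancel x hx y hy ih =>
    obtain ⟨ω, h1, h2, h3⟩ := ih
    obtain ⟨j, hj, rfl⟩ := hy
    rw [← h3, cs.inv_simple]
    exact exists_isReduced_mul_simple h1 h2 hj

theorem length_mul_of_minimal {h : W}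
    (hmin : ∀ u ∈ parabolic cs J, cs.length h ≤ cs.length (h * u)) (ω : List B)
    (hJ : ∀ x ∈ ω, x ∈ J) (hω : cs.IsReduced ω) :
    cs.length (h * cs.wordProd ω) = cs.length h + ω.length := by
  induction ω using List.reverseRecOn with
  | nil => simp
  | append_singleton ω s ih =>
    have hω' : cs.IsReduced ω := by simpa using hω.take ω.length
    have hJ' : ∀ x ∈ ω, x ∈ J := fun x hx => hJ x (by simp [hx])
    have hs : s ∈ J := hJ s (by simp)
    have ih' := ih hJ' hω'
    rw [← List.concat_eq_append, cs.wordProd_concat, ← mul_assoc, List.length_concat, ← add_assoc,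
      ← ih', ← cs.not_isRightDescent_iff]
    intro hd
    obtain ⟨η, hη, rfl⟩ := cs.exists_isReduced h
    rw [← cs.wordProd_append] at hd
    obtain ⟨n, hn, e⟩ := exists_eraseIdx cs hd
    rw [List.length_append] at hn
    rcases Nat.lt_or_ge n η.length with hlt | hge
    · rw [List.eraseIdx_append_of_lt_length hlt, cs.wordProd_append, cs.wordProd_append] at e
      have h1 := hmin (cs.wordProd ω * cs.simple s * (cs.wordProd ω)⁻¹)
        (mul_mem (mul_mem (wordProd_mem_parabolic hJ') (simple_mem_parabolic hs))
          (inv_mem (wordProd_mem_parabolic hJ')))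
      rw [← mul_assoc, ← mul_assoc, e, mul_inv_cancel_right, hη] at h1
      have h2 := cs.length_wordProd_le (η.eraseIdx n)
      rw [List.length_eraseIdx_of_lt hlt] at h2
      omega
    · rw [List.eraseIdx_append_of_length_le hge, cs.wordProd_append, cs.wordProd_append,
        mul_assoc] at e
      have e' := mul_left_cancel e
      have h2 := cs.length_wordProd_le (ω.eraseIdx (n - η.length))
      rw [← e', List.length_eraseIdx_of_lt (by omega), ← cs.wordProd_concat,
        List.concat_eq_append, hω, List.length_append] at h2
      omega

theorem exists_minimal (J : Set B) (g : W) : ∃ u ∈ parabolic cs J,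
    ∀ v ∈ parabolic cs J, cs.length (g * u) ≤ cs.length (g * u * v) := by
  have hne : (Set.range fun u : parabolic cs J => cs.length (g * u)).Nonempty :=
    ⟨_, ⟨1, rfl⟩⟩
  obtain ⟨⟨u, hu⟩, h1⟩ := Nat.sInf_mem hne
  refine ⟨u, hu, fun v hv => ?_⟩
  have h1' : cs.length (g * u) = _ := h1
  rw [h1']
  exact Nat.sInf_le ⟨⟨u * v, mul_mem hu hv⟩, by simp [mul_assoc]⟩

theorem length_mul_of_not_descent {h : W} (hd : ∀ j ∈ J, ¬ cs.IsRightDescent h j) {u : W}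
    (hu : u ∈ parabolic cs J) : cs.length (h * u) = cs.length h + cs.length u := by
  obtain ⟨v, hv, hmin⟩ := exists_minimal (cs := cs) J h
  obtain ⟨ω, h1, h2, h3⟩ := exists_isReduced_of_mem_parabolic (inv_mem hv)
  have hv1 : ω = [] := by
    rcases List.eq_nil_or_concat' ω with h0 | ⟨η, s, h0⟩
    · exact h0
    · exfalso
      have hη : cs.IsReduced η := by
        rw [h0] at h2
        simpa using h2.take η.length
      have a1 := length_mul_of_minimal hmin ω h1 h2
      have a2 := length_mul_of_minimal hmin η (fun x hx => h1 x (by simp [h0, hx])) hη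
      apply hd s (h1 s (by simp [h0]))
      rw [h3, mul_inv_cancel_right] at a1
      have e : h * v * cs.wordProd η = h * cs.simple s := by
        have : cs.wordProd η = v⁻¹ * cs.simple s := by
          rw [← h3, h0, ← List.concat_eq_append, cs.wordProd_concat]; simp
        rw [this]; group
      rw [e] at a2
      unfold CoxeterSystem.IsRightDescent
      rw [a1, a2, h0]
      simp
  rw [hv1, cs.wordProd_nil] at h3
  have hv2 : v = 1 := by simpa using h3.symm
  rw [hv2, mul_one] at hmin
  obtain ⟨η, e1, e2, rfl⟩ := exists_isReduced_of_mem_parabolic hu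
  rw [length_mul_of_minimal hmin η e1 e2, e2]

theorem exists_not_descent (J : Set B) (g : W) : ∃ h : W, h⁻¹ * g ∈ parabolic cs J ∧
    ∀ j ∈ J, ¬ cs.IsRightDescent h j := by
  obtain ⟨u, hu, hmin⟩ := exists_minimal (cs := cs) J g
  refine ⟨g * u, by simpa using hu, fun j hj hd => ?_⟩
  have := hmin _ (simple_mem_parabolic hj)
  unfold CoxeterSystem.IsRightDescent at hd
  omega

theorem eq_of_not_descent {h h' : W} (hd : ∀ j ∈ J, ¬ cs.IsRightDescent h j)
    (hd' : ∀ j ∈ J, ¬ cs.IsRightDescent h' j) (hmem : h⁻¹ * h' ∈ parabolic cs J) : h = h' := by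
  have h1 := length_mul_of_not_descent hd hmem
  have h2 := length_mul_of_not_descent hd' (inv_mem hmem)
  rw [cs.length_inv] at h2
  rw [mul_inv_cancel_left] at h1
  have : h' * (h⁻¹ * h')⁻¹ = h := by group
  rw [this] at h2
  have h3 : cs.length (h⁻¹ * h') = 0 := by omega
  rw [cs.length_eq_zero_iff] at h3
  exact (inv_mul_eq_one.1 h3)

theorem length_mul_of_descent {g : W} (hd : ∀ j ∈ J, cs.IsRightDescent g j) {u : W}
    (hu : u ∈ parabolic cs J) : cs.length (g * u) + cs.length u = cs.length g := by
  have key : ∀ ω : List B, (∀ x ∈ ω, x ∈ J) → cs.IsReduced ω →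
      cs.length (g * (cs.wordProd ω)⁻¹) + ω.length = cs.length g := by
    intro ω
    induction ω using List.reverseRecOn with
    | nil => intros; simp
    | append_singleton ω s ih =>
      intro hJ hω
      have hω' : cs.IsReduced ω := by simpa using hω.take ω.length
      have hJ' : ∀ x ∈ ω, x ∈ J := fun x hx => hJ x (by simp [hx])
      have ih' := ih hJ' hω'
      obtain ⟨η, hη, e⟩ := cs.exists_isReduced (g * (cs.wordProd ω)⁻¹)
      have eg : g = cs.wordProd (η ++ ω) := by
        rw [cs.wordProd_append, ← e]; group
      have hds := hd s (hJ s (by simp))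
      rw [eg] at hds
      obtain ⟨n, hn, e1⟩ := exists_eraseIdx cs hds
      rw [List.length_append] at hn
      rcases Nat.lt_or_ge n η.length with hlt | hge
      · rw [List.eraseIdx_append_of_lt_length hlt, ← eg, cs.wordProd_append] at e1
        have e2 : g * (cs.wordProd (ω ++ [s]))⁻¹ = cs.wordProd (η.eraseIdx n) := by
          rw [← List.concat_eq_append, cs.wordProd_concat, mul_inv_rev, cs.inv_simple, ← mul_assoc,
            e1, mul_inv_cancel_right]
        rw [e2]
        have h2 := cs.length_wordProd_le (η.eraseIdx n)
        rw [List.length_eraseIdx_of_lt hlt] at h2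
        have h3 := cs.length_le_length_mul_add_right g (cs.wordProd (ω ++ [s]))⁻¹
        rw [e2, cs.length_inv, hω] at h3
        have h4 : cs.length (cs.wordProd η) = η.length := hη
        rw [e, h4] at ih'
        rw [List.length_append, List.length_singleton] at *
        omega
      · rw [List.eraseIdx_append_of_length_le hge, cs.wordProd_append, cs.wordProd_append,
          mul_assoc] at e1
        have e' := mul_left_cancel e1
        have h2 := cs.length_wordProd_le (ω.eraseIdx (n - η.length))
        rw [← e', List.length_eraseIdx_of_lt (by omega), ← cs.wordProd_concat,
          List.concat_eq_append, hω, List.length_append] at h2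
        omega
  obtain ⟨ω, h1, h2, h3⟩ := exists_isReduced_of_mem_parabolic (inv_mem hu)
  have := key ω h1 h2
  have h4 : cs.length (cs.wordProd ω) = ω.length := h2
  rw [← h4, h3, inv_inv, cs.length_inv] at this
  exact this

end Parabolic

section Spherical

theorem finite_closure_of_cosets {G : Type*} [Group G] {a b c : G} (ha : a * a = 1)
    (hb : b * b = 1) (hc : c * c = 1) (H : Subgroup G) [Finite H] (C : List G) (h1 : 1 ∈ C)
    (hC : ∀ x ∈ C, (∃ y ∈ C, ∃ h ∈ H, x * a = h * y) ∧ (∃ y ∈ C, ∃ h ∈ H, x * b = h * y) ∧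
      (∃ y ∈ C, ∃ h ∈ H, x * c = h * y)) :
    Finite (Subgroup.closure {a, b, c}) := by
  have hC' : ∀ x ∈ C, ∀ s ∈ ({a, b, c} : Set G), ∃ y ∈ C, ∃ h ∈ H, x * s = h * y := by
    rintro x hx s (rfl | rfl | rfl)
    exacts [(hC x hx).1, (hC x hx).2.1, (hC x hx).2.2]
  have hinv : ∀ s ∈ ({a, b, c} : Set G), s⁻¹ = s := by
    rintro s (rfl | rfl | rfl)
    exacts [inv_eq_of_mul_eq_one_left ha, inv_eq_of_mul_eq_one_left hb,
      inv_eq_of_mul_eq_one_left hc]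
  let K : Set G := {g | ∃ h ∈ H, ∃ y ∈ C, g = h * y}
  have hK : K.Finite := by
    have : ((fun p : G × G => p.1 * p.2) '' ((H : Set G) ×ˢ {y | y ∈ C})).Finite :=
      Set.Finite.image _ (Set.Finite.prod (Set.toFinite _) (List.finite_toSet C))
    refine this.subset ?_
    rintro g ⟨h, hh, y, hy, rfl⟩
    exact ⟨(h, y), ⟨hh, hy⟩, rfl⟩
  have hstep : ∀ g ∈ K, ∀ s ∈ ({a, b, c} : Set G), g * s ∈ K := by
    rintro g ⟨h, hh, y, hy, rfl⟩ s hs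
    obtain ⟨y', hy', h', hh', e⟩ := hC' y hy s hs
    exact ⟨h * h', mul_mem hh hh', y', hy', by rw [mul_assoc, e, mul_assoc]⟩
  refine (hK.subset ?_ : ((Subgroup.closure {a, b, c} : Subgroup G) : Set G).Finite).to_subtype
  intro g hg
  induction hg using Subgroup.closure_induction_right with
  | one => exact ⟨1, one_mem _, 1, h1, by simp⟩
  | mul_right x hx y hy ih => exact hstep x ih y hy
  | mul_inv_cancel x hx y hy ih => rw [hinv y hy]; exact hstep x ih y hy

theorem finite_closure_pair {G : Type*} [Group G] {b c : G} (hb : b * b = 1) (hc : c * c = 1)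
    {m : ℕ} (hm : m ≠ 0) (hbc : (b * c) ^ m = 1) : Finite (Subgroup.closure {b, c}) := by
  have hb' : b⁻¹ = b := inv_eq_of_mul_eq_one_left hb
  have hfin : IsOfFinOrder (b * c) := isOfFinOrder_iff_pow_eq_one.2 ⟨m, Nat.pos_of_ne_zero hm, hbc⟩
  have hfin' : Finite (Subgroup.zpowers (b * c)) := hfin.finite_zpowers
  have hc' : c⁻¹ = c := inv_eq_of_mul_eq_one_left hc
  have mz : b * c ∈ Subgroup.zpowers (b * c) := Subgroup.mem_zpowers _
  have hbb : ∀ x, x * b * b = x := fun x => by rw [mul_assoc, hb, mul_one]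
  have h3 : Finite (Subgroup.closure {b, b, c}) := by
    refine finite_closure_of_cosets hb hb hc (Subgroup.zpowers (b * c)) [1, b] (by simp)
      fun x hx => ?_
    simp only [List.mem_cons, List.not_mem_nil, or_false] at hx
    rcases hx with rfl | h
    · refine ⟨⟨b, by simp, 1, one_mem _, by simp⟩, ⟨b, by simp, 1, one_mem _, by simp⟩,
        ⟨b, by simp, (b * c)⁻¹, inv_mem mz, by simp [hb', hc', mul_assoc, hb]⟩⟩
    · rw [h]
      refine ⟨⟨1, by simp, 1, one_mem _, by simp [hb]⟩, ⟨1, by simp, 1, one_mem _, by simp [hb]⟩,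
        ⟨1, by simp, b * c, mz, by simp⟩⟩
  rwa [Set.insert_eq_of_mem (by simp)] at h3

theorem finite_closure_commute {G : Type*} [Group G] {a b c : G} (ha : a * a = 1)
    (hb : b * b = 1) (hc : c * c = 1) (hab : a * b = b * a) (hac : a * c = c * a)
    [Finite (Subgroup.closure {b, c})] : Finite (Subgroup.closure {a, b, c}) := by
  have mb : b ∈ Subgroup.closure {b, c} := Subgroup.subset_closure (by simp)
  have mc : c ∈ Subgroup.closure {b, c} := Subgroup.subset_closure (by simp)
  refine finite_closure_of_cosets ha hb hc (Subgroup.closure {b, c}) [1, a] (by simp)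
    fun x hx => ?_
  simp only [List.mem_cons, List.not_mem_nil, or_false] at hx
  rcases hx with rfl | h
  · refine ⟨⟨a, by simp, 1, one_mem _, by simp⟩, ⟨1, by simp, b, mb, by simp⟩,
      ⟨1, by simp, c, mc, by simp⟩⟩
  · rw [h]
    exact ⟨⟨1, by simp, 1, one_mem _, by simp [ha]⟩, ⟨a, by simp, b, mb, hab⟩,
      ⟨a, by simp, c, mc, hac⟩⟩

theorem finite_closure_A3 {G : Type*} [Group G] {a b c : G} (ha : a * a = 1) (hb : b * b = 1)
    (hc : c * c = 1) (hab : a * b = b * a) (hac : a * c * a = c * a * c)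
    (hbc : b * c * b = c * b * c) [Finite (Subgroup.closure {b, c})] :
    Finite (Subgroup.closure {a, b, c}) := by
  have rab : ∀ x, a * (b * x) = b * (a * x) := fun x => by
    simpa only [mul_assoc] using congrArg (· * x) hab
  have rac : ∀ x, a * (c * (a * x)) = c * (a * (c * x)) := fun x => by
    simpa only [mul_assoc] using congrArg (· * x) hac
  have rbc : ∀ x, b * (c * (b * x)) = c * (b * (c * x)) := fun x => by
    simpa only [mul_assoc] using congrArg (· * x) hbc
  have mb : b ∈ Subgroup.closure {b, c} := Subgroup.subset_closure (by simp)
  have mc : c ∈ Subgroup.closure {b, c} := Subgroup.subset_closure (by simp)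
  refine finite_closure_of_cosets ha hb hc (Subgroup.closure {b, c})
    [1, a, a * c, a * c * b]
    (by simp) fun x hx => ?_
  simp only [List.mem_cons, List.not_mem_nil, or_false] at hx
  rcases hx with rfl | h | rfl | rfl
  · refine ⟨⟨a, by simp, 1, one_mem _, by simp⟩,
      ⟨1, by simp, b, mb, by simp⟩,
      ⟨1, by simp, c, mc, by simp⟩⟩
  · rw [h]
    refine ⟨⟨1, by simp, 1, one_mem _, by simp [ha]⟩,
      ⟨a, by simp, b, mb, by
      simpa only [mul_assoc, mul_one, one_mul] using (show a * (b * 1) = b * (a * 1) by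
        rw [rab 1])⟩,
      ⟨a * c, by simp, 1, one_mem _, by simp⟩⟩
  · refine ⟨⟨a * c, by simp, c, mc, by
      simpa only [mul_assoc, mul_one, one_mul] using (show a * (c * (a * 1)) = c * (a * (c * 1)) by
        rw [rac 1])⟩,
      ⟨a * c * b, by simp, 1, one_mem _, by simp⟩,
      ⟨a, by simp, 1, one_mem _, by simp [mul_assoc, hc]⟩⟩
  · refine ⟨⟨a * c * b, by simp, c, mc, by
      simpa only [mul_assoc, mul_one, one_mul] using (show a * (c * (b * (a * 1))) = c * (a * (c * (b * 1))) by
        rw [← rab 1, rac (b * 1)])⟩,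
      ⟨a * c, by simp, 1, one_mem _, by simp [mul_assoc, hb]⟩,
      ⟨a * c * b, by simp, b, mb, by
      simpa only [mul_assoc, mul_one, one_mul] using (show a * (c * (b * (c * 1))) = b * (a * (c * (b * 1))) by
        rw [← rbc 1, rab (c * (b * 1))])⟩⟩

theorem finite_closure_B3 {G : Type*} [Group G] {a b c : G} (ha : a * a = 1) (hb : b * b = 1)
    (hc : c * c = 1) (hab : a * b = b * a) (hac : a * c * a = c * a * c)
    (hbc : b * c * b * c = c * b * c * b) [Finite (Subgroup.closure {b, c})] :
    Finite (Subgroup.closure {a, b, c}) := by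
  have rab : ∀ x, a * (b * x) = b * (a * x) := fun x => by
    simpa only [mul_assoc] using congrArg (· * x) hab
  have rac : ∀ x, a * (c * (a * x)) = c * (a * (c * x)) := fun x => by
    simpa only [mul_assoc] using congrArg (· * x) hac
  have rbc : ∀ x, b * (c * (b * (c * x))) = c * (b * (c * (b * x))) := fun x => by
    simpa only [mul_assoc] using congrArg (· * x) hbc
  have mb : b ∈ Subgroup.closure {b, c} := Subgroup.subset_closure (by simp)
  have mc : c ∈ Subgroup.closure {b, c} := Subgroup.subset_closure (by simp)
  refine finite_closure_of_cosets ha hb hc (Subgroup.closure {b, c})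
    [1, a, a * c, a * c * b, a * c * b * c, a * c * b * c * a]
    (by simp) fun x hx => ?_
  simp only [List.mem_cons, List.not_mem_nil, or_false] at hx
  rcases hx with rfl | h | rfl | rfl | rfl | rfl
  · refine ⟨⟨a, by simp, 1, one_mem _, by simp⟩,
      ⟨1, by simp, b, mb, by simp⟩,
      ⟨1, by simp, c, mc, by simp⟩⟩
  · rw [h]
    refine ⟨⟨1, by simp, 1, one_mem _, by simp [ha]⟩,
      ⟨a, by simp, b, mb, by
      simpa only [mul_assoc, mul_one, one_mul] using (show a * (b * 1) = b * (a * 1) by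
        rw [rab 1])⟩,
      ⟨a * c, by simp, 1, one_mem _, by simp⟩⟩
  · refine ⟨⟨a * c, by simp, c, mc, by
      simpa only [mul_assoc, mul_one, one_mul] using (show a * (c * (a * 1)) = c * (a * (c * 1)) by
        rw [rac 1])⟩,
      ⟨a * c * b, by simp, 1, one_mem _, by simp⟩,
      ⟨a, by simp, 1, one_mem _, by simp [mul_assoc, hc]⟩⟩
  · refine ⟨⟨a * c * b, by simp, c, mc, by
      simpa only [mul_assoc, mul_one, one_mul] using (show a * (c * (b * (a * 1))) = c * (a * (c * (b * 1))) by
        rw [← rab 1, rac (b * 1)])⟩,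
      ⟨a * c, by simp, 1, one_mem _, by simp [mul_assoc, hb]⟩,
      ⟨a * c * b * c, by simp, 1, one_mem _, by simp⟩⟩
  · refine ⟨⟨a * c * b * c * a, by simp, 1, one_mem _, by simp⟩,
      ⟨a * c * b * c, by simp, b, mb, by
      simpa only [mul_assoc, mul_one, one_mul] using (show a * (c * (b * (c * (b * 1)))) = b * (a * (c * (b * (c * 1)))) by
        rw [← rbc 1, rab (c * (b * (c * 1)))])⟩,
      ⟨a * c * b, by simp, 1, one_mem _, by simp [mul_assoc, hc]⟩⟩
  · refine ⟨⟨a * c * b * c, by simp, 1, one_mem _, by simp [mul_assoc, ha]⟩,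
      ⟨a * c * b * c * a, by simp, b, mb, by
      simpa only [mul_assoc, mul_one, one_mul] using (show a * (c * (b * (c * (a * (b * 1))))) = b * (a * (c * (b * (c * (a * 1))))) by
        rw [rab 1, ← rbc (a * 1), rab (c * (b * (c * (a * 1))))])⟩,
      ⟨a * c * b * c * a, by simp, c, mc, by
      simpa only [mul_assoc, mul_one, one_mul] using (show a * (c * (b * (c * (a * (c * 1))))) = c * (a * (c * (b * (c * (a * 1))))) by
        rw [← rac 1, ← rab (c * (a * 1)), rac (b * (c * (a * 1)))])⟩⟩

theorem finite_closure_H3 {G : Type*} [Group G] {a b c : G} (ha : a * a = 1) (hb : b * b = 1)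
    (hc : c * c = 1) (hab : a * b = b * a) (hac : a * c * a = c * a * c)
    (hbc : b * c * b * c * b = c * b * c * b * c) [Finite (Subgroup.closure {b, c})] :
    Finite (Subgroup.closure {a, b, c}) := by
  have rab : ∀ x, a * (b * x) = b * (a * x) := fun x => by
    simpa only [mul_assoc] using congrArg (· * x) hab
  have rac : ∀ x, a * (c * (a * x)) = c * (a * (c * x)) := fun x => by
    simpa only [mul_assoc] using congrArg (· * x) hac
  have rbc : ∀ x, b * (c * (b * (c * (b * x)))) = c * (b * (c * (b * (c * x)))) := fun x => by
    simpa only [mul_assoc] using congrArg (· * x) hbc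
  have mb : b ∈ Subgroup.closure {b, c} := Subgroup.subset_closure (by simp)
  have mc : c ∈ Subgroup.closure {b, c} := Subgroup.subset_closure (by simp)
  refine finite_closure_of_cosets ha hb hc (Subgroup.closure {b, c})
    [1, a, a * c, a * c * b, a * c * b * c, a * c * b * c * a, a * c * b * c * b, a * c * b * c * a * b, a * c * b * c * a * b * c, a * c * b * c * a * b * c * b, a * c * b * c * a * b * c * b * c, a * c * b * c * a * b * c * b * c * a]
    (by simp) fun x hx => ?_
  simp only [List.mem_cons, List.not_mem_nil, or_false] at hx
  rcases hx with rfl | h | rfl | rfl | rfl | rfl | rfl | rfl | rfl | rfl | rfl | rfl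
  · refine ⟨⟨a, by simp, 1, one_mem _, by simp⟩,
      ⟨1, by simp, b, mb, by simp⟩,
      ⟨1, by simp, c, mc, by simp⟩⟩
  · rw [h]
    refine ⟨⟨1, by simp, 1, one_mem _, by simp [ha]⟩,
      ⟨a, by simp, b, mb, by
      simpa only [mul_assoc, mul_one, one_mul] using (show a * (b * 1) = b * (a * 1) by
        rw [rab 1])⟩,
      ⟨a * c, by simp, 1, one_mem _, by simp⟩⟩
  · refine ⟨⟨a * c, by simp, c, mc, by
      simpa only [mul_assoc, mul_one, one_mul] using (show a * (c * (a * 1)) = c * (a * (c * 1)) by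
        rw [rac 1])⟩,
      ⟨a * c * b, by simp, 1, one_mem _, by simp⟩,
      ⟨a, by simp, 1, one_mem _, by simp [mul_assoc, hc]⟩⟩
  · refine ⟨⟨a * c * b, by simp, c, mc, by
      simpa only [mul_assoc, mul_one, one_mul] using (show a * (c * (b * (a * 1))) = c * (a * (c * (b * 1))) by
        rw [← rab 1, rac (b * 1)])⟩,
      ⟨a * c, by simp, 1, one_mem _, by simp [mul_assoc, hb]⟩,
      ⟨a * c * b * c, by simp, 1, one_mem _, by simp⟩⟩
  · refine ⟨⟨a * c * b * c * a, by simp, 1, one_mem _, by simp⟩,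
      ⟨a * c * b * c * b, by simp, 1, one_mem _, by simp⟩,
      ⟨a * c * b, by simp, 1, one_mem _, by simp [mul_assoc, hc]⟩⟩
  · refine ⟨⟨a * c * b * c, by simp, 1, one_mem _, by simp [mul_assoc, ha]⟩,
      ⟨a * c * b * c * a * b, by simp, 1, one_mem _, by simp⟩,
      ⟨a * c * b * c * a, by simp, c, mc, by
      simpa only [mul_assoc, mul_one, one_mul] using (show a * (c * (b * (c * (a * (c * 1))))) = c * (a * (c * (b * (c * (a * 1))))) by
        rw [← rac 1, ← rab (c * (a * 1)), rac (b * (c * (a * 1)))])⟩⟩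
  · refine ⟨⟨a * c * b * c * a * b, by simp, 1, one_mem _, by
      simpa only [mul_assoc, mul_one, one_mul] using (show a * (c * (b * (c * (b * (a * 1))))) = a * (c * (b * (c * (a * (b * 1))))) by
        rw [← rab 1])⟩,
      ⟨a * c * b * c, by simp, 1, one_mem _, by simp [mul_assoc, hb]⟩,
      ⟨a * c * b * c * b, by simp, b, mb, by
      simpa only [mul_assoc, mul_one, one_mul] using (show a * (c * (b * (c * (b * (c * 1))))) = b * (a * (c * (b * (c * (b * 1))))) by
        rw [← rbc 1, rab (c * (b * (c * (b * 1))))])⟩⟩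
  · refine ⟨⟨a * c * b * c * b, by simp, 1, one_mem _, by
      have e : a * c * b * c * a * b = a * c * b * c * b * a := by
        simpa only [mul_assoc, mul_one, one_mul] using (show a * (c * (b * (c * (a * (b * 1))))) = a * (c * (b * (c * (b * (a * 1))))) by
          rw [rab 1])
      rw [e, mul_assoc _ a a, ha, mul_one, one_mul]⟩,
      ⟨a * c * b * c * a, by simp, 1, one_mem _, by simp [mul_assoc, hb]⟩,
      ⟨a * c * b * c * a * b * c, by simp, 1, one_mem _, by simp⟩⟩
  · refine ⟨⟨a * c * b * c * a * b * c, by simp, b, mb, by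
      simpa only [mul_assoc, mul_one, one_mul] using (show a * (c * (b * (c * (a * (b * (c * (a * 1))))))) = b * (a * (c * (b * (c * (a * (b * (c * 1))))))) by
        rw [rab (c * (a * 1)), rac 1, ← rbc (a * (c * 1)), rab (c * (b * (c * (b * (a * (c * 1)))))), ← rab (c * 1)])⟩,
      ⟨a * c * b * c * a * b * c * b, by simp, 1, one_mem _, by simp⟩,
      ⟨a * c * b * c * a * b, by simp, 1, one_mem _, by simp [mul_assoc, hc]⟩⟩
  · refine ⟨⟨a * c * b * c * a * b * c * b, by simp, b, mb, by
      simpa only [mul_assoc, mul_one, one_mul] using (show a * (c * (b * (c * (a * (b * (c * (b * (a * 1)))))))) = b * (a * (c * (b * (c * (a * (b * (c * (b * 1)))))))) by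
        rw [rab (c * (b * (a * 1))), ← rab 1, rac (b * 1), ← rbc (a * (c * (b * 1))), rab (c * (b * (c * (b * (a * (c * (b * 1))))))), ← rab (c * (b * 1))])⟩,
      ⟨a * c * b * c * a * b * c, by simp, 1, one_mem _, by simp [mul_assoc, hb]⟩,
      ⟨a * c * b * c * a * b * c * b * c, by simp, 1, one_mem _, by simp⟩⟩
  · refine ⟨⟨a * c * b * c * a * b * c * b * c * a, by simp, 1, one_mem _, by simp⟩,
      ⟨a * c * b * c * a * b * c * b * c, by simp, c, mc, by
      simpa only [mul_assoc, mul_one, one_mul] using (show a * (c * (b * (c * (a * (b * (c * (b * (c * (b * 1))))))))) = c * (a * (c * (b * (c * (a * (b * (c * (b * (c * 1))))))))) by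
        rw [rbc 1, ← rac (b * (c * (b * (c * 1)))), ← rab (c * (a * (b * (c * (b * (c * 1)))))), rac (b * (c * (a * (b * (c * (b * (c * 1)))))))])⟩,
      ⟨a * c * b * c * a * b * c * b, by simp, 1, one_mem _, by simp [mul_assoc, hc]⟩⟩
  · refine ⟨⟨a * c * b * c * a * b * c * b * c, by simp, 1, one_mem _, by simp [mul_assoc, ha]⟩,
      ⟨a * c * b * c * a * b * c * b * c * a, by simp, c, mc, by
      simpa only [mul_assoc, mul_one, one_mul] using (show a * (c * (b * (c * (a * (b * (c * (b * (c * (a * (b * 1)))))))))) = c * (a * (c * (b * (c * (a * (b * (c * (b * (c * (a * 1)))))))))) by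
        rw [rab 1, rbc (a * 1), ← rac (b * (c * (b * (c * (a * 1))))), ← rab (c * (a * (b * (c * (b * (c * (a * 1))))))), rac (b * (c * (a * (b * (c * (b * (c * (a * 1))))))))])⟩,
      ⟨a * c * b * c * a * b * c * b * c * a, by simp, b, mb, by
      simpa only [mul_assoc, mul_one, one_mul] using (show a * (c * (b * (c * (a * (b * (c * (b * (c * (a * (c * 1)))))))))) = b * (a * (c * (b * (c * (a * (b * (c * (b * (c * (a * 1)))))))))) by
        rw [rab (c * (b * (c * (a * (c * 1))))), ← rac 1, ← rab (c * (a * 1)), rac (b * (c * (a * 1))), ← rbc (a * (c * (b * (c * (a * 1))))), rab (c * (b * (c * (b * (a * (c * (b * (c * (a * 1))))))))), ← rab (c * (b * (c * (a * 1))))])⟩⟩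

end Spherical

section Descents

variable {cs : CoxeterSystem M W} {g : W} {a b c : B}

local notation "𝒟" => CoxeterSystem.IsRightDescent cs
local notation:70 g:70 "⋆" a:71 => g * CoxeterSystem.simple cs a

theorem descent_mul_self : 𝒟 (g ⋆ a) a ↔ ¬ 𝒟 g a := by
  rw [cs.isRightDescent_iff_not_isRightDescent_mul, cs.simple_mul_simple_cancel_right]

theorem length_of_descent (h : 𝒟 g a) : cs.length (g ⋆ a) < cs.length g := h

theorem forall_pair {p : B → Prop} (ha : p a) (hb : p b) : ∀ j ∈ ({a, b} : Set B), p j := by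
  rintro j (rfl | rfl)
  exacts [ha, hb]

theorem mem_of_mem_alternatingWord (a b : B) (k : ℕ) :
    ∀ x ∈ alternatingWord a b k, x ∈ ({a, b} : Set B) := by
  induction k with
  | zero => simp [alternatingWord]
  | succ k ih =>
    rw [alternatingWord_succ']
    intro x hx
    rcases List.mem_cons.1 hx with rfl | hx
    · split_ifs <;> simp
    · exact ih x hx

theorem length_mul_inv_alternatingWord (ha : 𝒟 g a) (hb : 𝒟 g b) (hab : a ≠ b) {k : ℕ}
    (hk : M a b = 0 ∨ k ≤ M a b) :
    cs.length (g * (cs.wordProd (alternatingWord b a k))⁻¹) + k = cs.length g := by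
  have h1 := isReduced_alternatingWord cs hab.symm (n := k) (by rwa [M.symmetric b a])
  have h2 := length_mul_of_descent (J := {a, b}) (g := g) (forall_pair ha hb)
    (inv_mem (wordProd_mem_parabolic fun x hx => by
      rw [Set.pair_comm]; exact mem_of_mem_alternatingWord b a k x hx))
  have h3 : cs.length _ = _ := h1
  rw [cs.length_inv, h3, length_alternatingWord] at h2
  exact h2

theorem entry_ne_zero (ha : 𝒟 g a) (hb : 𝒟 g b) : M a b ≠ 0 := by
  intro h0
  have hab : a ≠ b := by
    rintro rfl
    rw [M.diagonal] at h0
    omega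
  have := length_mul_inv_alternatingWord ha hb hab (k := cs.length g + 1) (Or.inl h0)
  omega

theorem descent_alternating (ha : 𝒟 g a) (hb : 𝒟 g b) (hab : a ≠ b) {k : ℕ} (hk : k < M a b) :
    𝒟 (g * (cs.wordProd (alternatingWord b a k))⁻¹) (if Even k then a else b) := by
  have h1 := length_mul_inv_alternatingWord ha hb hab (k := k) (Or.inr hk.le)
  have h2 := length_mul_inv_alternatingWord ha hb hab (k := k + 1) (Or.inr hk)
  rw [alternatingWord_succ', cs.wordProd_cons, mul_inv_rev, cs.inv_simple, ← mul_assoc] at h2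
  unfold CoxeterSystem.IsRightDescent
  omega

theorem two_le_entry (ha : 𝒟 g a) (hb : 𝒟 g b) (hab : a ≠ b) : 2 ≤ M a b := by
  have h0 := entry_ne_zero ha hb
  have h1 : M a b ≠ 1 := M.off_diagonal a b hab
  omega

theorem descent_one (ha : 𝒟 g a) (hb : 𝒟 g b) (hab : a ≠ b) : 𝒟 (g ⋆ a) b := by
  have := descent_alternating ha hb hab (k := 1) (by have := two_le_entry ha hb hab; omega)
  simpa [alternatingWord, wordProd, mul_assoc] using this

theorem descent_two (ha : 𝒟 g a) (hb : 𝒟 g b) (hab : a ≠ b) (hM : 3 ≤ M a b) :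
    𝒟 (g ⋆ a ⋆ b) a := by
  have := descent_alternating ha hb hab (k := 2) (by omega)
  simpa [alternatingWord, wordProd, mul_assoc] using this

theorem descent_three (ha : 𝒟 g a) (hb : 𝒟 g b) (hab : a ≠ b) (hM : 4 ≤ M a b) :
    𝒟 (g ⋆ a ⋆ b ⋆ a) b := by
  have := descent_alternating ha hb hab (k := 3) (by omega)
  simpa [alternatingWord, wordProd, mul_assoc, show ¬ Even 3 by decide] using this

theorem descent_four (ha : 𝒟 g a) (hb : 𝒟 g b) (hab : a ≠ b) (hM : 5 ≤ M a b) :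
    𝒟 (g ⋆ a ⋆ b ⋆ a ⋆ b) a := by
  have := descent_alternating ha hb hab (k := 4) (by omega)
  simpa [alternatingWord, wordProd, mul_assoc, show Even 4 by decide] using this

theorem descent_five (ha : 𝒟 g a) (hb : 𝒟 g b) (hab : a ≠ b) (hM : 6 ≤ M a b) :
    𝒟 (g ⋆ a ⋆ b ⋆ a ⋆ b ⋆ a) b := by
  have := descent_alternating ha hb hab (k := 5) (by omega)
  simpa [alternatingWord, wordProd, mul_assoc, show ¬ Even 5 by decide] using this

theorem commute (hM : M a b = 2) (g : W) : g ⋆ a ⋆ b = g ⋆ b ⋆ a := by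
  have h := cs.simple_mul_simple_pow a b
  rw [hM, pow_two] at h
  have h' := eq_inv_of_mul_eq_one_left h
  rw [mul_inv_rev, cs.inv_simple, cs.inv_simple] at h'
  rw [mul_assoc, h', mul_assoc]

theorem braid (hM : M a b = 3) (g : W) : g ⋆ a ⋆ b ⋆ a = g ⋆ b ⋆ a ⋆ b := by
  have h := cs.simple_mul_simple_pow a b
  rw [hM, show 3 = 1 + 1 + 1 by rfl, pow_add, pow_add, pow_one] at h
  have h1 : cs.simple a * cs.simple b * cs.simple a =
      cs.simple b * cs.simple a * cs.simple b := by
    have h2 : cs.simple a * cs.simple b * cs.simple a *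
        (cs.simple b * cs.simple a * cs.simple b) = 1 := by
      simpa only [mul_assoc] using h
    have h3 := eq_inv_of_mul_eq_one_left h2
    rw [h3]
    simp [mul_assoc]
  simpa only [mul_assoc] using congrArg (g * ·) h1

theorem entry_ne {a b : B} {n : ℕ} (hM : M a b = n) (hn : n ≠ 1) : a ≠ b := by
  rintro rfl
  rw [M.diagonal] at hM
  omega

theorem descent_of_commute (hM : M a b = 2) (h : 𝒟 g b) : 𝒟 (g ⋆ a) b := by
  have hab : a ≠ b := entry_ne hM (by norm_num)
  by_cases ha : 𝒟 g a
  · exact descent_one ha h hab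
  · by_contra hn
    rw [cs.not_isRightDescent_iff] at hn ha
    rw [cs.isRightDescent_iff] at h
    rw [commute hM] at hn
    have := cs.length_mul_le (g ⋆ b) (cs.simple a)
    rw [cs.length_simple] at this
    omega

theorem descent_commute_iff (hM : M a b = 2) : 𝒟 (g ⋆ a) b ↔ 𝒟 g b := by
  refine ⟨fun h => ?_, descent_of_commute hM⟩
  have := descent_of_commute hM h
  rwa [cs.simple_mul_simple_cancel_right] at this

section TwoDim

variable (h2 : TwoDimensional cs)
include h2

theorem no_three_descents [Finite B] (hab : a ≠ b) (hac : a ≠ c) (hbc : b ≠ c) (ha : 𝒟 g a) (hb : 𝒟 g b)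
    (hc : 𝒟 g c) : False := by
  have hinf := h2 a b c hab hac hbc
  have hJ : ∀ j ∈ ({a, b, c} : Set B), 𝒟 g j := by
    rintro j (rfl | rfl | rfl)
    exacts [ha, hb, hc]
  have e : ({cs.simple a, cs.simple b, cs.simple c} : Set W) = cs.simple '' {a, b, c} := by
    simp [Set.image_insert_eq]
  rw [e] at hinf
  have hfin : ((parabolic cs {a, b, c} : Subgroup W) : Set W).Finite := by
    refine ((List.finite_length_le B (cs.length g)).image cs.wordProd).subset ?_
    intro u hu
    obtain ⟨ω, h1, h3, rfl⟩ := exists_isReduced_of_mem_parabolic hu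
    refine ⟨ω, ?_, rfl⟩
    have := length_mul_of_descent hJ hu
    have h4 : cs.length _ = _ := h3
    simp only [Set.mem_ofPred_eq]
    omega
  exact hinf.not_finite hfin.to_subtype

theorem entry_eq_zero_of_commute (hbc : b ≠ c) (hab : M a b = 2) (hac : M a c = 2) : M b c = 0 := by
  by_contra h0
  have ha := cs.simple_mul_simple_self a
  have hb := cs.simple_mul_simple_self b
  have hc := cs.simple_mul_simple_self c
  have := finite_closure_pair hb hc h0 (cs.simple_mul_simple_pow b c)
  have hfin := finite_closure_commute ha hb hc (by simpa using commute (cs := cs) hab 1)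
    (by simpa using commute (cs := cs) hac 1)
  exact (h2 a b c (entry_ne hab (by norm_num)) (entry_ne hac (by norm_num)) hbc).not_finite hfin

theorem six_le_entry (hbc : b ≠ c) (hab : M a b = 2) (hac : M a c = 3) (h0 : M b c ≠ 0) :
    6 ≤ M b c := by
  have ha := cs.simple_mul_simple_self a
  have hb := cs.simple_mul_simple_self b
  have hc := cs.simple_mul_simple_self c
  have h1 : M b c ≠ 1 := M.off_diagonal b c hbc
  have := finite_closure_pair hb hc h0 (cs.simple_mul_simple_pow b c)
  have habc := (h2 a b c (entry_ne hab (by norm_num)) (entry_ne hac (by norm_num)) hbc).not_finite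
  have eab : cs.simple a * cs.simple b = cs.simple b * cs.simple a := by
    simpa using commute (cs := cs) hab 1
  have eac : cs.simple a * cs.simple c * cs.simple a = cs.simple c * cs.simple a * cs.simple c := by
    simpa using braid (cs := cs) hac 1
  have ebc := cs.wordProd_braidWord_eq c b
  unfold braidWord at ebc
  rw [M.symmetric c b] at ebc
  by_contra hlt
  have : M b c = 2 ∨ M b c = 3 ∨ M b c = 4 ∨ M b c = 5 := by omega
  rcases this with h | h | h | h
  · have := entry_eq_zero_of_commute h2 (entry_ne hac (by norm_num)) (by rwa [M.symmetric]) h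
    omega
  all_goals rw [h] at ebc; simp only [alternatingWord, wordProd, List.concat_eq_append,
    List.nil_append, List.cons_append, List.map_cons, List.map_nil, List.prod_cons,
    List.prod_nil, mul_one] at ebc; apply habc
  · exact finite_closure_A3 ha hb hc eab eac (by simpa only [mul_assoc] using ebc)
  · exact finite_closure_B3 ha hb hc eab eac (by simpa only [mul_assoc] using ebc.symm)
  · exact finite_closure_H3 ha hb hc eab eac (by simpa only [mul_assoc] using ebc)

end TwoDim

section Projection

theorem wg_spec (g : W) : wg cs g ∈ descSubgroup cs g ∧
    ∀ u ∈ descSubgroup cs g, cs.length u ≤ cs.length (wg cs g) := by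
  have hex : ∃ w₀ ∈ descSubgroup cs g, ∀ u ∈ descSubgroup cs g, cs.length u ≤ cs.length w₀ := by
    have hb : ∀ u ∈ descSubgroup cs g, cs.length u ≤ cs.length g := by
      intro u hu
      have := length_mul_of_descent (J := descentSet cs g) (fun j hj => hj) hu
      omega
    have hbdd : BddAbove (cs.length '' (descSubgroup cs g : Set W)) := by
      refine ⟨cs.length g, ?_⟩
      rintro _ ⟨u, hu, rfl⟩
      exact hb u hu
    obtain ⟨w, hw, e⟩ := Nat.sSup_mem (Set.Nonempty.image _ ⟨1, one_mem (descSubgroup cs g)⟩) hbdd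
    refine ⟨w, hw, fun u hu => ?_⟩
    rw [e]
    exact le_csSup hbdd ⟨u, hu, rfl⟩
  unfold wg
  rw [dif_pos hex]
  exact hex.choose_spec

theorem inv_mul_piMap_mem (g : W) : g⁻¹ * PiMap cs g ∈ parabolic cs (descentSet cs g) := by
  unfold PiMap
  rw [inv_mul_cancel_left]
  exact (wg_spec g).1

theorem not_descent_piMap (h : 𝒟 g a) : ¬ 𝒟 (PiMap cs g) a := by
  obtain ⟨h1, h2⟩ := wg_spec (cs := cs) g
  have h3 := length_mul_of_descent (J := descentSet cs g) (fun j hj => hj) h1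
  have h4 : wg cs g ⋆ a ∈ parabolic cs (descentSet cs g) := mul_mem h1 (simple_mem_parabolic h)
  have h5 := length_mul_of_descent (J := descentSet cs g) (fun j hj => hj) h4
  have h6 := h2 _ h4
  unfold CoxeterSystem.IsRightDescent PiMap
  rw [mul_assoc]
  omega

theorem parabolic_mono {J K : Set B} (h : J ⊆ K) : parabolic cs J ≤ parabolic cs K :=
  Subgroup.closure_mono (Set.image_mono h)

theorem piMap_mem_pair (h : ∀ z, 𝒟 g z → z = a ∨ z = b) :
    g⁻¹ * PiMap cs g ∈ parabolic cs {a, b} :=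
  parabolic_mono (fun z hz => h z hz) (inv_mul_piMap_mem g)

theorem eq_piMap {h : W} (hT : ∀ z, 𝒟 g z ↔ z = a ∨ z = b) (ha : ¬ 𝒟 h a) (hb : ¬ 𝒟 h b)
    (hmem : g⁻¹ * h ∈ parabolic cs {a, b}) : PiMap cs g = h := by
  refine eq_of_not_descent (J := {a, b})
    (forall_pair (not_descent_piMap ((hT a).2 (Or.inl rfl)))
      (not_descent_piMap ((hT b).2 (Or.inr rfl)))) (forall_pair ha hb) ?_
  have := mul_mem (inv_mem (piMap_mem_pair fun z hz => (hT z).1 hz)) hmem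
  rwa [show (g⁻¹ * PiMap cs g)⁻¹ * (g⁻¹ * h) = (PiMap cs g)⁻¹ * h by group] at this

theorem piMap_single (hT : ∀ z, 𝒟 g z ↔ z = a) : PiMap cs g = g ⋆ a := by
  have ha : ¬ 𝒟 (g ⋆ a) a := by
    rw [descent_mul_self, not_not, hT]
  refine eq_piMap (a := a) (b := a) (by simpa using hT) ha ha ?_
  rw [inv_mul_cancel_left]
  exact simple_mem_parabolic (by simp)

theorem piMap_commute (hT : ∀ z, 𝒟 g z ↔ z = a ∨ z = b) (hM : M a b = 2) :
    PiMap cs g = g ⋆ a ⋆ b := by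
  have ha := (hT a).2 (Or.inl rfl)
  have hb := (hT b).2 (Or.inr rfl)
  have hab := entry_ne hM (by norm_num)
  refine eq_piMap hT ?_ ?_ ?_
  · rw [commute hM, descent_mul_self, not_not]
    exact descent_one hb ha hab.symm
  · rw [descent_mul_self, not_not]
    exact descent_one ha hb hab
  · rw [mul_assoc, inv_mul_cancel_left]
    exact mul_mem (simple_mem_parabolic (by simp)) (simple_mem_parabolic (by simp))

theorem piMap_braid (hT : ∀ z, 𝒟 g z ↔ z = a ∨ z = b) (hM : M a b = 3) :
    PiMap cs g = g ⋆ a ⋆ b ⋆ a := by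
  have ha := (hT a).2 (Or.inl rfl)
  have hb := (hT b).2 (Or.inr rfl)
  have hab := entry_ne hM (by norm_num)
  refine eq_piMap hT ?_ ?_ ?_
  · rw [descent_mul_self, not_not]
    exact descent_two ha hb hab hM.ge
  · rw [braid hM, descent_mul_self, not_not]
    exact descent_two hb ha hab.symm (by rw [M.symmetric]; exact hM.ge)
  · rw [mul_assoc, mul_assoc, inv_mul_cancel_left]
    exact mul_mem (simple_mem_parabolic (by simp))
      (mul_mem (simple_mem_parabolic (by simp)) (simple_mem_parabolic (by simp)))

end Projection

end Descents

section Configurations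

variable {cs : CoxeterSystem M W} (h2 : TwoDimensional cs)
include h2

local notation "𝒟" => CoxeterSystem.IsRightDescent cs
local notation:70 g:70 "⋆" a:71 => g * CoxeterSystem.simple cs a

omit h2 in
/-- Infinite descent in a triangle with labels `3`, `2` and at least `6`. -/
theorem no_descending_configuration {p q o : B} (hpq : M p q = 3) (hqo : M q o = 2)
    (hpo : 6 ≤ M p o) : ∀ (n : ℕ) (e : W), cs.length e = n → 𝒟 e p → 𝒟 e q → 𝒟 (e ⋆ p) o →
      𝒟 (e ⋆ p ⋆ o) p → False := by
  intro n
  induction n using Nat.strong_induction_on with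
  | _ n ih =>
  intro e hn h1 h3 h4 h5
  have npq : p ≠ q := entry_ne hpq (by norm_num)
  have nqo : q ≠ o := entry_ne hqo (by norm_num)
  have npo : p ≠ o := by
    rintro rfl
    rw [M.diagonal] at hpo
    omega
  have hop : 6 ≤ M o p := by rwa [M.symmetric]
  have a1 := descent_one h1 h3 npq
  have a2 : 𝒟 (e ⋆ p ⋆ o) q := descent_of_commute (by rwa [M.symmetric]) a1
  have a3 := descent_two h1 h3 npq hpq.ge
  have a4 : 𝒟 (e ⋆ p ⋆ q) o := descent_of_commute hqo h4
  have b1 := descent_one a4 a3 npo.symm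
  have b2 := descent_two a4 a3 npo.symm (by omega)
  have b3 := descent_three a4 a3 npo.symm (by omega)
  have b4 := descent_four a4 a3 npo.symm (by omega)
  have b5 := descent_five a4 a3 npo.symm (by omega)
  have c1 := descent_two a2 h5 npq.symm (by rw [M.symmetric]; exact hpq.ge)
  rw [commute (a := o) (b := q) (by rwa [M.symmetric])] at c1
  have c2 := descent_one b2 c1 nqo.symm
  refine ih _ ?_ (e ⋆ p ⋆ q ⋆ o ⋆ p ⋆ o) rfl b3 c2 b4 b5
  have l1 := length_of_descent h1
  have l2 := length_of_descent a1
  have l3 := length_of_descent a4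
  have l4 := length_of_descent b1
  have l5 := length_of_descent b2
  omega

/-- The basic local configuration: `p`, `o` are descents of `g`, and `q` one of `gp`. -/
theorem entries_of_descents [Finite B] : ∀ (n : ℕ) (g : W) (p q o : B), cs.length g = n → p ≠ q →
    p ≠ o → q ≠ o → 𝒟 g p → 𝒟 g o → 𝒟 (g ⋆ p) q →
    M p q ≠ 2 ∧ (M p o = 2 ∨ (M q o = 2 ∧ M p o = 3 ∧ 6 ≤ M p q)) := by
  intro n
  induction n using Nat.strong_induction_on with
  | _ n ih =>
  intro g p q o hn npq npo nqo hp ho hq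
  have hpq2 : M p q ≠ 2 := fun h =>
    no_three_descents h2 npq npo nqo hp ((descent_commute_iff h).1 hq) ho
  refine ⟨hpq2, ?_⟩
  by_contra hcon
  push Not at hcon
  obtain ⟨hpo2, hcon⟩ := hcon
  have hpo3 : 3 ≤ M p o := by have := two_le_entry hp ho npo; omega
  have a1 := descent_one hp ho npo
  have a2 := descent_two hp ho npo hpo3
  have a3 := descent_one a1 hq nqo.symm
  have hpq := two_le_entry a2 a3 npq
  have hoq := two_le_entry a1 hq nqo.symm
  have l1 := length_of_descent hp
  have l2 := length_of_descent a1
  have sqo := M.symmetric q o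
  have spo := M.symmetric p o
  have spq := M.symmetric p q
  by_cases hqo2 : M q o = 2
  · by_cases hpo : M p o = 3
    · have := six_le_entry h2 npq.symm (by rw [← sqo, hqo2]) (by rw [← spo, hpo])
        (by rw [← spq]; omega)
      have := hcon hqo2 hpo
      omega
    by_cases hpq3 : M p q = 3
    · have := six_le_entry h2 npo.symm hqo2 (by rw [← spq, hpq3]) (by rw [← spo]; omega)
      exact no_descending_configuration hpq3 hqo2 (by omega) _ _ rfl a2 a3
        (descent_three hp ho npo (by omega)) (descent_four hp ho npo (by omega))
    · have := ih _ (by omega) (g ⋆ p ⋆ o) p o q rfl npo npq nqo.symm a2 a3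
        (descent_three hp ho npo (by omega))
      omega
  · have := ih _ (by omega) (g ⋆ p) o p q rfl npo.symm nqo.symm npq a1 hq a2
    omega

theorem entries_spec [Finite B] {g : W} {p q o : B} (npq : p ≠ q) (npo : p ≠ o) (nqo : q ≠ o)
    (hp : 𝒟 g p) (ho : 𝒟 g o) (hq : 𝒟 (g ⋆ p) q) :
    M p q ≠ 2 ∧ (M p o = 2 ∨ (M q o = 2 ∧ M p o = 3 ∧ 6 ≤ M p q)) :=
  entries_of_descents h2 _ g p q o rfl npq npo nqo hp ho hq

omit h2 in
theorem no_descents_of_braid {x y r : B} (hxr : M x r = 2) (hyr : M y r = 3) (hxy : 6 ≤ M x y) :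
    ∀ (n : ℕ) (c : W), cs.length c = n → 𝒟 c y → 𝒟 c r → 𝒟 (c ⋆ y) x → 𝒟 (c ⋆ y ⋆ x) y →
      False := by
  intro n
  induction n using Nat.strong_induction_on with
  | _ n ih =>
  intro c hn hy hr h3 h4
  have nxr : x ≠ r := entry_ne hxr (by norm_num)
  have nyr : y ≠ r := entry_ne hyr (by norm_num)
  have nxy : x ≠ y := by
    rintro rfl
    rw [M.diagonal] at hxy
    omega
  have hrx : M r x = 2 := by rwa [M.symmetric]
  have a1 := descent_one hy hr nyr
  have a2 := descent_two hy hr nyr hyr.ge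
  have a3 : 𝒟 (c ⋆ y ⋆ r) x := descent_of_commute hrx h3
  have a4 : 𝒟 (c ⋆ y ⋆ x) r := descent_of_commute hxr a1
  have a5 := descent_two a4 h4 nyr.symm (by rw [M.symmetric]; exact hyr.ge)
  rw [commute hxr] at a5
  have b1 := descent_one a3 a2 nxy
  have b2 := descent_two a3 a2 nxy (by omega)
  have b3 := descent_three a3 a2 nxy (by omega)
  have b4 := descent_four a3 a2 nxy (by omega)
  have b5 := descent_five a3 a2 nxy (by omega)
  refine ih _ ?_ _ rfl b3 (descent_of_commute hxr a5) b4 b5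
  have l1 := length_of_descent hy
  have l2 := length_of_descent a1
  have l3 := length_of_descent a3
  have l4 := length_of_descent b1
  have l5 := length_of_descent b2
  omega

/-- An element with four alternating `p, q`-descents has no descents other than `p, q`. -/
theorem no_other_descent [Finite B] {g : W} {p q z : B} (h0 : M p q ≠ 0) (npq : p ≠ q)
    (h1 : 𝒟 g p) (h3 : 𝒟 (g ⋆ p) q) (h4 : 𝒟 (g ⋆ p ⋆ q) p) (h5 : 𝒟 (g ⋆ p ⋆ q ⋆ p) q)
    (hz : 𝒟 g z) : z = p ∨ z = q := by
  by_contra hcon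
  push Not at hcon
  obtain ⟨nzp, nzq⟩ := hcon
  obtain ⟨-, e1⟩ := entries_spec h2 npq nzp.symm nzq.symm h1 hz h3
  have hz' := descent_one h1 hz nzp.symm
  obtain ⟨-, e2⟩ := entries_spec h2 npq.symm nzq.symm nzp.symm h3 hz' h4
  have szp := M.symmetric z p
  have szq := M.symmetric z q
  have spq := M.symmetric p q
  rcases e1 with e1 | ⟨e1, e1', e1''⟩
  · rcases e2 with e2 | ⟨-, e2, e2'⟩
    · exact h0 (entry_eq_zero_of_commute h2 npq (by rw [szp, e1]) (by rw [szq, e2]))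
    · exact no_descents_of_braid e1 e2 (by omega) _ _ rfl h3 hz' h4 h5
  · exact no_descents_of_braid e1 e1' (by omega) _ _ rfl h1 hz h3 h4

/-- The consequence of `no_other_descent` just below the top of a dihedral coset. -/
theorem no_other_descent_of_pair [Finite B] {t : W} {p q z : B} (npq : p ≠ q) (hp : 𝒟 t p)
    (hq : 𝒟 t q) (hM : 6 ≤ M p q) (hz : 𝒟 (t ⋆ p) z) : z = q := by
  have a1 := descent_one hp hq npq
  have := no_other_descent h2 (by rw [M.symmetric]; omega) npq.symm a1
    (descent_two hp hq npq (by omega)) (descent_three hp hq npq (by omega))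
    (descent_four hp hq npq (by omega)) hz
  rcases this with h | rfl
  · exact h
  · exact absurd hp (by rwa [← descent_mul_self])

theorem entry_eq_three_aux [Finite B] {x y r : B} (nxy : x ≠ y) (hxr : 3 ≤ M x r)
    (hyr : 3 ≤ M y r) : ∀ (n : ℕ) (h : W), cs.length h = n → ¬ 𝒟 h x → ¬ 𝒟 h y →
      𝒟 (h ⋆ x) r → 𝒟 (h ⋆ y) r → M y r = 3 := by
  intro n
  induction n using Nat.strong_induction_on with
  | _ n ih =>
  intro h hn hx hy h3 h4
  have nxr : x ≠ r := by
    rintro rfl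
    rw [M.diagonal] at hxr
    omega
  have nyr : y ≠ r := by
    rintro rfl
    rw [M.diagonal] at hyr
    omega
  have hx' := descent_mul_self.2 hx
  have hy' := descent_mul_self.2 hy
  have sxy := M.symmetric x y
  have sxr := M.symmetric x r
  have syr := M.symmetric y r
  have a0 := descent_one hx' h3 nxr
  have a1 := descent_two hx' h3 nxr hxr
  have a2 := descent_two hy' h4 nyr hyr
  rw [cs.simple_mul_simple_cancel_right] at a0 a1 a2
  by_contra hcon
  have a3 := descent_three hy' h4 nyr (by omega)
  rw [cs.simple_mul_simple_cancel_right] at a3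
  have a4 := descent_one a2 a1 nxy.symm
  obtain ⟨-, e⟩ := entries_spec h2 nyr nxy.symm nxr.symm a2 a1 a3
  have hyx : M y x = 2 := by
    rcases e with e | ⟨e, -⟩
    · exact e
    · omega
  by_cases hxr3 : M x r = 3
  · have h0 := entry_ne_zero hy' h4
    have h6 := six_le_entry h2 nyr (by rw [sxy, hyx]) hxr3 h0
    have a5 := descent_four hy' h4 nyr (by omega)
    have a6 := descent_five hy' h4 nyr (by omega)
    rw [cs.simple_mul_simple_cancel_right] at a5 a6
    exact no_descents_of_braid hyx (by rw [← sxr, hxr3]) h6 _ _ rfl a3 a4 a5 a6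
  · have b3 := descent_three hx' h3 nxr (by omega)
    rw [cs.simple_mul_simple_cancel_right] at b3
    have b4 := descent_one a1 a2 nxy
    refine hcon (ih _ ?_ (h ⋆ r ⋆ x ⋆ y) rfl ?_ ?_ ?_ ?_)
    · have l1 := length_of_descent a0
      have l2 := length_of_descent a1
      have l3 := length_of_descent b4
      omega
    · rwa [commute (sxy.trans hyx), descent_mul_self, not_not]
    · rwa [descent_mul_self, not_not]
    · rwa [commute (sxy.trans hyx), cs.simple_mul_simple_cancel_right]
    · rwa [cs.simple_mul_simple_cancel_right]

theorem entries_eq_three [Finite B] {h : W} {x y r : B} (nxy : x ≠ y) (hx : ¬ 𝒟 h x)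
    (hy : ¬ 𝒟 h y) (h3 : 𝒟 (h ⋆ x) r) (h4 : 𝒟 (h ⋆ y) r) (hxr : 3 ≤ M x r) (hyr : 3 ≤ M y r) :
    M x r = 3 ∧ M y r = 3 :=
  ⟨entry_eq_three_aux h2 nxy.symm hyr hxr _ h rfl hy hx h4 h3,
    entry_eq_three_aux h2 nxy hxr hyr _ h rfl hx hy h3 h4⟩

end Configurations

/-- `a` lies in the coset `t⟨p, r⟩`. -/
def InCoset (cs : CoxeterSystem M W) (t : W) (p r : B) (a : W) : Prop :=
  t⁻¹ * a ∈ parabolic cs {p, r}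

/-- Some iterates of `Π` at `g` and `g'`, of order at most three and not both trivial, lie in a
common coset of a finite parabolic subgroup of rank at most two. -/
def IteratesMeet (cs : CoxeterSystem M W) (g g' : W) : Prop :=
  ∃ k k' : ℕ, k ≤ 3 ∧ k' ≤ 3 ∧ 0 < k + k' ∧ ∃ (t : W) (p r : B), M p r ≠ 0 ∧
    InCoset cs t p r ((PiMap cs)^[k] g) ∧ InCoset cs t p r ((PiMap cs)^[k'] g')

/-- `h` is the shortest element of its coset of the finite dihedral group `⟨x, y⟩`. -/
structure IsBase (cs : CoxeterSystem M W) (h : W) (x y : B) : Prop where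
  ne : x ≠ y
  entry : M x y ≠ 0
  left : ¬ cs.IsRightDescent h x
  right : ¬ cs.IsRightDescent h y

/-- `g` is reached from `h` along the edge `x, y, x`, with `r` a descent all the way. -/
def IsSide (cs : CoxeterSystem M W) (h : W) (x y r : B) (g : W) : Prop :=
  cs.IsRightDescent (h * cs.simple x) r ∧ (g = h * cs.simple x ∨
    (g = h * cs.simple x * cs.simple y ∧ cs.IsRightDescent g y ∧ cs.IsRightDescent g r) ∨
    (g = h * cs.simple x * cs.simple y * cs.simple x ∧
      cs.IsRightDescent (h * cs.simple x * cs.simple y) y ∧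
      cs.IsRightDescent (h * cs.simple x * cs.simple y) r ∧
      cs.IsRightDescent g x ∧ cs.IsRightDescent g r))

/-- The descent `r` persists at `g = hx`, or at `g = hxy` where `r` commutes with `y` but not
with `x`. -/
def IsShortSide (cs : CoxeterSystem M W) (h : W) (x y r : B) (g : W) : Prop :=
  cs.IsRightDescent (h * cs.simple x) r ∧ (g = h * cs.simple x ∨
    (g = h * cs.simple x * cs.simple y ∧ cs.IsRightDescent g y ∧ cs.IsRightDescent g r ∧
      M y r = 2 ∧ 3 ≤ M x r))

section Proof

variable {cs : CoxeterSystem M W} {g g' h t a c : W} {p r s x y z w : B}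

local notation "𝒟" => CoxeterSystem.IsRightDescent cs
local notation:70 g:70 "⋆" a:71 => g * CoxeterSystem.simple cs a

theorem InCoset.refl : InCoset cs t p r t := by
  unfold InCoset
  rw [inv_mul_cancel]
  exact one_mem _

theorem InCoset.left (h : InCoset cs t p r a) : InCoset cs t p r (a ⋆ p) := by
  unfold InCoset
  rw [← mul_assoc]
  exact mul_mem h (simple_mem_parabolic (by simp))

theorem InCoset.right (h : InCoset cs t p r a) : InCoset cs t p r (a ⋆ r) := by
  unfold InCoset
  rw [← mul_assoc]
  exact mul_mem h (simple_mem_parabolic (by simp))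

theorem InCoset.trans (h : InCoset cs t p r a) (h' : InCoset cs a p r c) : InCoset cs t p r c := by
  unfold InCoset at *
  simpa [mul_assoc] using mul_mem h h'

theorem InCoset.symm (h : InCoset cs t p r a) : InCoset cs a p r t := by
  unfold InCoset at *
  simpa using inv_mem h

theorem InCoset.swap (h : InCoset cs t p r a) : InCoset cs t r p a := by
  unfold InCoset at *
  rwa [Set.pair_comm]

theorem InCoset.eq_or_eq (h : InCoset cs t p p a) : a = t ∨ a = t ⋆ p := by
  have key : ∀ u ∈ parabolic cs {p, p}, u = 1 ∨ u = cs.simple p := by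
    intro u hu
    unfold parabolic at hu
    induction hu using Subgroup.closure_induction with
    | mem u hu => simp_all
    | one => exact Or.inl rfl
    | mul u v _ _ hu hv => rcases hu with rfl | rfl <;> rcases hv with rfl | rfl <;> simp
    | inv u _ hu => rcases hu with rfl | rfl <;> simp
  rcases key _ h with e | e
  · exact Or.inl (inv_mul_eq_one.1 e).symm
  · exact Or.inr (inv_mul_eq_iff_eq_mul.1 e)

theorem IteratesMeet.symm (h : IteratesMeet cs g g') : IteratesMeet cs g' g := by
  obtain ⟨k, k', h1, h2, h3, t, p, r, h4, h5, h6⟩ := h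
  exact ⟨k', k, h2, h1, by omega, t, p, r, h4, h6, h5⟩

theorem IteratesMeet.of_one (hM : M p r ≠ 0) (h : InCoset cs t p r (PiMap cs g))
    (h' : InCoset cs t p r (PiMap cs g')) : IteratesMeet cs g g' :=
  ⟨1, 1, by norm_num, by norm_num, by norm_num, t, p, r, hM, h, h'⟩

theorem IsBase.symm (hb : IsBase cs h x y) : IsBase cs h y x :=
  ⟨hb.ne.symm, by rw [M.symmetric]; exact hb.entry, hb.right, hb.left⟩

theorem IsBase.descent (hb : IsBase cs h x y) : 𝒟 (h ⋆ x) x := descent_mul_self.2 hb.left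

theorem IsBase.ne_left (hb : IsBase cs h x y) (hr : 𝒟 h r) : x ≠ r := by
  rintro rfl
  exact hb.left hr

theorem IsBase.descent_of_descent (hb : IsBase cs h x y) (nxz : x ≠ z) (hz : 𝒟 (h ⋆ x) z) :
    𝒟 h z := by
  have := descent_one hb.descent hz nxz
  rwa [cs.simple_mul_simple_cancel_right] at this

section TwoDim

variable [Finite B] (h2 : TwoDimensional cs)
include h2

theorem descent_iff_of_pair (nxy : x ≠ y) (hx : 𝒟 g x) (hy : 𝒟 g y) (z : B) :
    𝒟 g z ↔ z = x ∨ z = y := by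
  refine ⟨fun hz => ?_, by rintro (rfl | rfl) <;> assumption⟩
  by_contra hcon
  push Not at hcon
  exact no_three_descents h2 nxy hcon.1.symm hcon.2.symm hx hy hz

theorem piMap_piMap_of_braid (hrw : M r w = 2) (hyr : M y r = 3) (hy : 𝒟 c y) (hr : 𝒟 c r)
    (hw : ¬ 𝒟 c w) (hT : ∀ z, 𝒟 (c ⋆ y ⋆ r ⋆ y) z ↔ z = w) :
    PiMap cs (PiMap cs (c ⋆ r)) = c ⋆ y ⋆ r ⋆ y ⋆ w := by
  have nyr : y ≠ r := entry_ne hyr (by norm_num)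
  have hry : M r y = 3 := by rw [M.symmetric]; exact hyr
  have nrw : r ≠ w := entry_ne hrw (by norm_num)
  have a1 : 𝒟 (c ⋆ r) y := descent_one hr hy nyr.symm
  have a2 : 𝒟 (c ⋆ r ⋆ y) r := descent_two hr hy nyr.symm (by omega)
  have a3 : 𝒟 (c ⋆ r ⋆ y) w := by
    have := (descent_commute_iff (cs := cs) hrw (g := c ⋆ r ⋆ y)).1
    refine this ?_
    rw [← braid hyr, hT]
  have e1 : PiMap cs (c ⋆ r) = c ⋆ r ⋆ y := by
    refine piMap_single fun z => ⟨fun hz => ?_, by rintro rfl; exact a1⟩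
    by_contra nzy
    have nzr : z ≠ r := by
      rintro rfl
      exact descent_mul_self.1 hz hr
    have b1 := descent_one a1 hz (Ne.symm nzy)
    have b2 := descent_one a2 b1 nzr.symm
    rw [← braid hyr, hT] at b2
    subst b2
    exact hw ((descent_commute_iff hrw).1 hz)
  rw [e1, piMap_commute (descent_iff_of_pair h2 nrw a2 a3) hrw, braid hyr]

theorem isSide_of_inCoset (hb : IsBase cs h x y) (hg : InCoset cs h x y g) (hr : 𝒟 g r)
    (nxr : x ≠ r) (nyr : y ≠ r) (hx : 𝒟 g x) : IsSide cs h x y r g ∨ IsSide cs h y x r g := by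
  have key : ∀ g, InCoset cs h x y g → ¬ 𝒟 g x → ¬ 𝒟 g y → g = h := fun g hg h1 h3 =>
    (eq_of_not_descent (J := {x, y}) (forall_pair hb.left hb.right) (forall_pair h1 h3) hg).symm
  have c0 : ¬ 𝒟 (g ⋆ x) x := by rwa [descent_mul_self, not_not]
  have r1 := descent_one hx hr nxr
  unfold IsSide
  by_cases d1 : 𝒟 (g ⋆ x) y
  swap
  · left
    rw [← key _ hg.left c0 d1, cs.simple_mul_simple_cancel_right]
    exact ⟨hr, Or.inl rfl⟩
  have c1 : ¬ 𝒟 (g ⋆ x ⋆ y) y := by rwa [descent_mul_self, not_not]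
  have r2 := descent_one d1 r1 nyr
  by_cases d2 : 𝒟 (g ⋆ x ⋆ y) x
  swap
  · right
    rw [← key _ hg.left.right d2 c1]
    simp only [cs.simple_mul_simple_cancel_right]
    exact ⟨r1, Or.inr (Or.inl ⟨trivial, hx, hr⟩)⟩
  left
  have c2 : ¬ 𝒟 (g ⋆ x ⋆ y ⋆ x) x := by rwa [descent_mul_self, not_not]
  by_cases d3 : 𝒟 (g ⋆ x ⋆ y ⋆ x) y
  · have := no_other_descent h2 hb.entry hb.ne hx d1 d2 d3 hr
    tauto
  · rw [← key _ hg.left.right.left c2 d3]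
    simp only [cs.simple_mul_simple_cancel_right]
    exact ⟨r2, Or.inr (Or.inr ⟨trivial, d1, r1, hx, hr⟩)⟩

theorem eq_or_isSide (hb : IsBase cs h x y) (hg : InCoset cs h x y g) (hr : 𝒟 g r)
    (nxr : x ≠ r) (nyr : y ≠ r) :
    𝒟 h r ∧ (g = h ∨ IsSide cs h x y r g ∨ IsSide cs h y x r g) := by
  by_cases hx : 𝒟 g x
  · have := isSide_of_inCoset h2 hb hg hr nxr nyr hx
    refine ⟨?_, Or.inr this⟩
    rcases this with h1 | h1
    exacts [hb.descent_of_descent nxr h1.1, hb.symm.descent_of_descent nyr h1.1]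
  by_cases hy : 𝒟 g y
  · have := (isSide_of_inCoset h2 hb.symm hg.swap hr nyr nxr hy).symm
    refine ⟨?_, Or.inr this⟩
    rcases this with h1 | h1
    exacts [hb.descent_of_descent nxr h1.1, hb.symm.descent_of_descent nyr h1.1]
  · have e : g = h := (eq_of_not_descent (J := {x, y}) (forall_pair hb.left hb.right)
      (forall_pair hx hy) hg).symm
    exact ⟨e ▸ hr, Or.inl e⟩

theorem iterate_mem_of_six_le (hb : IsBase cs h x y) (h1 : 𝒟 (h ⋆ x ⋆ y) y)
    (h3 : 𝒟 (h ⋆ x ⋆ y) r) (hxr : M x r = 2) (hyr : M y r = 3) (hxy : 6 ≤ M x y)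
    (hg : InCoset cs h x y g) (hp : 𝒟 g p) (nxp : x ≠ p) (nyp : y ≠ p) :
    ∃ k, 0 < k ∧ k ≤ 3 ∧ InCoset cs (h ⋆ r ⋆ x) x y ((PiMap cs)^[k] g) := by
  have nxr : x ≠ r := entry_ne hxr (by norm_num)
  have nyr : y ≠ r := entry_ne hyr (by norm_num)
  have nxy := hb.ne
  have hyx : 6 ≤ M y x := by rw [M.symmetric]; exact hxy
  have hrx : M r x = 2 := by rw [M.symmetric]; exact hxr
  have a0 := hb.descent
  have a1 : 𝒟 (h ⋆ x) r := by
    have := descent_one h1 h3 nyr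
    rwa [cs.simple_mul_simple_cancel_right] at this
  have hr : 𝒟 h r := hb.descent_of_descent nxr a1
  have ecom := commute (cs := cs) hrx h
  have tx : 𝒟 (h ⋆ r ⋆ x) x := by
    rw [ecom]; exact descent_one a1 a0 nxr.symm
  have ty : 𝒟 (h ⋆ r ⋆ x) y := by
    have := descent_two h1 h3 nyr (by omega)
    rwa [cs.simple_mul_simple_cancel_right, ← ecom] at this
  have T1 : ∀ z, 𝒟 (h ⋆ r) z ↔ z = y := fun z => by
    have := no_other_descent_of_pair h2 nxy tx ty hxy (z := z)
    have h' := descent_one tx ty nxy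
    rw [cs.simple_mul_simple_cancel_right] at this h'
    exact ⟨this, by rintro rfl; exact h'⟩
  have T2 : ∀ z, 𝒟 (h ⋆ r ⋆ y) z ↔ z = x := fun z => by
    have b1 := descent_two tx ty nxy (by omega)
    have b2 := descent_three tx ty nxy (by omega)
    have b3 := descent_four tx ty nxy (by omega)
    have b4 := descent_five tx ty nxy (by omega)
    rw [cs.simple_mul_simple_cancel_right] at b1 b2 b3 b4
    refine ⟨fun hz => ?_, by rintro rfl; exact b1⟩
    refine (no_other_descent h2 hb.entry nxy b1 b2 b3 b4 hz).resolve_right ?_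
    rintro rfl
    exact descent_mul_self.1 hz ((T1 _).2 rfl)
  have T0 : ∀ z, 𝒟 h z ↔ z = r := fun z => by
    refine ⟨fun hz => ?_, by rintro rfl; exact hr⟩
    by_contra nzr
    have := (T1 z).1 (descent_one hr hz (Ne.symm nzr))
    subst this
    exact hb.right hz
  have Tf : ∀ z, 𝒟 (h ⋆ r ⋆ x ⋆ y) z ↔ z = x := fun z =>
    ⟨no_other_descent_of_pair h2 nxy.symm ty tx hyx,
      by rintro rfl; exact descent_one ty tx nxy.symm⟩
  have i0 : InCoset cs (h ⋆ r ⋆ x) x y (h ⋆ r) := by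
    have := (InCoset.refl (cs := cs) (t := h ⋆ r ⋆ x) (p := x) (r := y)).left
    rwa [cs.simple_mul_simple_cancel_right] at this
  obtain ⟨hp', hside⟩ := eq_or_isSide h2 hb hg hp nxp nyp
  obtain rfl : p = r := (T0 p).1 hp'
  rcases hside with rfl | ⟨s1, rfl | ⟨rfl, s2, s3⟩ | ⟨rfl, s2, s3, s4, s5⟩⟩ |
    ⟨s1, rfl | ⟨rfl, s2, s3⟩ | ⟨rfl, s2, s3, s4, s5⟩⟩
  · refine ⟨1, by norm_num, by norm_num, ?_⟩
    rw [Function.iterate_one, piMap_single T0]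
    exact i0
  · refine ⟨1, by norm_num, by norm_num, ?_⟩
    rw [Function.iterate_one, piMap_commute (descent_iff_of_pair h2 nxr a0 a1) hxr,
      cs.simple_mul_simple_cancel_right]
    exact i0
  · refine ⟨1, by norm_num, by norm_num, ?_⟩
    rw [Function.iterate_one, piMap_braid (descent_iff_of_pair h2 nyr h1 h3) hyr,
      cs.simple_mul_simple_cancel_right, ← ecom]
    exact InCoset.refl.right
  · refine ⟨3, by norm_num, by norm_num, ?_⟩
    change InCoset cs _ _ _ (PiMap cs (PiMap cs (PiMap cs _)))
    rw [piMap_commute (descent_iff_of_pair h2 nxr s4 s5) hxr, cs.simple_mul_simple_cancel_right,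
      piMap_piMap_of_braid h2 hrx hyr h1 h3 (descent_mul_self.1 s4)]
    all_goals rw [cs.simple_mul_simple_cancel_right, ← ecom]
    · exact InCoset.refl.right.left
    · exact Tf
  · refine ⟨1, by norm_num, by norm_num, ?_⟩
    rw [Function.iterate_one, piMap_braid (descent_iff_of_pair h2 nyr hb.symm.descent s1) hyr,
      cs.simple_mul_simple_cancel_right]
    exact i0.right
  · refine ⟨3, by norm_num, by norm_num, ?_⟩
    change InCoset cs _ _ _ (PiMap cs (PiMap cs (PiMap cs _)))
    rw [piMap_commute (descent_iff_of_pair h2 nxr s2 s3) hxr, cs.simple_mul_simple_cancel_right,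
      piMap_piMap_of_braid h2 hrx hyr hb.symm.descent s1 (descent_mul_self.1 s2)]
    all_goals rw [cs.simple_mul_simple_cancel_right]
    · exact i0.right.left
    · exact T2
  · refine (no_descents_of_braid hxr hyr hxy _ _ rfl s4 s5 ?_ ?_).elim
    all_goals simp only [cs.simple_mul_simple_cancel_right]
    exacts [s2, hb.symm.descent]

/-- A persistent descent either sits on a short side or forces labels `2`, `3` and at least
`6`. -/
theorem IsSide.isShortSide_or (hb : IsBase cs h x y) (nxr : x ≠ r) (nyr : y ≠ r)
    (hg : IsSide cs h x y r g) :
    IsShortSide cs h x y r g ∨ (𝒟 (h ⋆ x ⋆ y) y ∧ 𝒟 (h ⋆ x ⋆ y) r ∧ M x r = 2 ∧ M y r = 3 ∧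
      6 ≤ M x y) := by
  have hsymm : M x y = M y x := M.symmetric x y
  have nxy := hb.ne
  obtain ⟨s1, rfl | ⟨rfl, h1, h3⟩ | ⟨rfl, h1, h3, h4, h5⟩⟩ := hg
  · exact Or.inl ⟨s1, Or.inl rfl⟩
  · have e := (entries_spec h2 nxy.symm nyr nxr h1 h3
      (by rw [cs.simple_mul_simple_cancel_right]; exact hb.descent)).2
    by_cases hyr : M y r = 2
    · refine Or.inl ⟨s1, Or.inr ⟨rfl, h1, h3, hyr, ?_⟩⟩
      have e1 := two_le_entry hb.descent s1 nxr
      have e2 : M x r ≠ 2 := fun h => hb.entry (entry_eq_zero_of_commute h2 (a := r) nxy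
        (by rwa [M.symmetric]) (by rwa [M.symmetric]))
      omega
    · right
      have := e.resolve_left hyr
      exact ⟨h1, h3, this.1, this.2.1, by omega⟩
  · right
    have e := (entries_spec h2 nxy.symm nyr nxr h1 h3
      (by rw [cs.simple_mul_simple_cancel_right]; exact hb.descent)).2
    have e' := (entries_spec h2 nxy nxr nyr h4 h5
      (by rw [cs.simple_mul_simple_cancel_right]; exact h1)).2
    have e2 : M x r = 2 → M y r ≠ 2 := fun h h' =>
      hb.entry (entry_eq_zero_of_commute h2 (a := r) nxy
        (by rwa [M.symmetric]) (by rwa [M.symmetric]))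
    rcases e' with e' | ⟨e3, e4, e5⟩
    · have := e.resolve_left (e2 e')
      exact ⟨h1, h3, this.1, this.2.1, by omega⟩
    · refine (no_descents_of_braid e3 e4 (by omega) _ _ rfl h4 h5 ?_ ?_).elim
      all_goals simp only [cs.simple_mul_simple_cancel_right]
      exacts [h1, hb.descent]

section SingleDescent

variable (hb : IsBase cs h x y) (nxr : x ≠ r) (nyr : y ≠ r)
include hb nxr nyr

theorem IsShortSide.piMap_mem (hg : IsShortSide cs h x y r g) :
    InCoset cs (h ⋆ r) x r (PiMap cs g) := by
  obtain ⟨s1, rfl | ⟨rfl, h1, h3, hM, -⟩⟩ := hg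
  · refine InCoset.trans (a := h ⋆ x) ?_ (piMap_mem_pair fun z hz =>
      (descent_iff_of_pair h2 nxr hb.descent s1 z).1 hz)
    have := (InCoset.refl (cs := cs) (t := h) (p := x) (r := r))
    exact InCoset.trans this.right.symm this.left
  · rw [piMap_commute (descent_iff_of_pair h2 nyr h1 h3) hM, cs.simple_mul_simple_cancel_right]
    have := (InCoset.refl (cs := cs) (t := h) (p := x) (r := r))
    exact InCoset.trans this.right.symm this.left.right

end SingleDescent

theorem piMap_of_commute (hb : IsBase cs h x y) (hg : IsShortSide cs h x y r g)
    (hM : M x r = 2) : PiMap cs g = h ⋆ r := by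
  obtain ⟨s1, rfl | ⟨rfl, h1, h3, -, h4⟩⟩ := hg
  · rw [piMap_commute (descent_iff_of_pair h2 (entry_ne hM (by norm_num)) hb.descent s1) hM,
      cs.simple_mul_simple_cancel_right]
  · omega

/-- Elements on opposite sides when `r` is the only descent of the base. -/
theorem iteratesMeet_of_single (hb : IsBase cs h x y) (nxr : x ≠ r) (nyr : y ≠ r)
    (hg : IsShortSide cs h x y r g) (hg' : IsShortSide cs h y x r g') : IteratesMeet cs g g' := by
  have e0 := entry_ne_zero hb.descent hg.1
  have e0' := entry_ne_zero hb.symm.descent hg'.1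
  have e2 := two_le_entry hb.descent hg.1 nxr
  have e2' := two_le_entry hb.symm.descent hg'.1 nyr
  by_cases hyr : M y r = 2
  · refine .of_one e0 (hg.piMap_mem h2 hb nxr nyr) ?_
    rw [piMap_of_commute h2 hb.symm hg' hyr]
    exact .refl
  by_cases hxr : M x r = 2
  · refine .of_one e0' ?_ (hg'.piMap_mem h2 hb.symm nyr nxr)
    rw [piMap_of_commute h2 hb hg hxr]
    exact .refl
  obtain ⟨s1, rfl | ⟨rfl, -, -, h3, -⟩⟩ := hg
  swap
  · exact (hyr h3).elim
  obtain ⟨s1', rfl | ⟨rfl, -, -, h3, -⟩⟩ := hg'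
  swap
  · exact (hxr h3).elim
  obtain ⟨m1, m2⟩ := entries_eq_three h2 hb.ne hb.left hb.right s1 s1' (by omega) (by omega)
  refine .of_one (t := h ⋆ r) hb.entry ?_ ?_
  · rw [piMap_braid (descent_iff_of_pair h2 nxr hb.descent s1) m1,
      cs.simple_mul_simple_cancel_right]
    exact InCoset.refl.left
  · rw [piMap_braid (descent_iff_of_pair h2 nyr hb.symm.descent s1') m2,
      cs.simple_mul_simple_cancel_right]
    exact InCoset.refl.right

/-- A short side over a base with a second descent `w`. -/
theorem IsShortSide.cases (hb : IsBase cs h x y) (hr : 𝒟 h r) (hw : 𝒟 h w) (nrw : r ≠ w)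
    (hg : IsShortSide cs h x y r g) :
    (M x r = 2 ∧ g = h ⋆ x ∧ PiMap cs g = h ⋆ r) ∨
      (M r w = 2 ∧ M x r = 3 ∧ 6 ≤ M x w ∧ 𝒟 (h ⋆ r) x ∧
        ∃ k, 0 < k ∧ k ≤ 3 ∧ InCoset cs (h ⋆ r) x w ((PiMap cs)^[k] g)) := by
  have nxr := hb.ne_left hr
  have nxw := hb.ne_left hw
  have nyr := hb.symm.ne_left hr
  have e := (entries_spec h2 nxw nxr nrw.symm hb.descent hg.1
      (by rwa [cs.simple_mul_simple_cancel_right])).2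
  rcases e with e | ⟨e1, e3, e4⟩
  · left
    refine ⟨e, ?_, piMap_of_commute h2 hb hg e⟩
    obtain ⟨s1, rfl | ⟨rfl, -, -, -, h4⟩⟩ := hg
    · rfl
    · omega
  right
  have hrw : M r w = 2 := by rw [M.symmetric]; exact e1
  have T := descent_iff_of_pair h2 nxr hb.descent hg.1
  have d1 : 𝒟 (h ⋆ r) x := by
    have := descent_two hb.descent hg.1 nxr (by omega)
    rwa [cs.simple_mul_simple_cancel_right] at this
  have d2 := descent_one hr hw nrw
  refine ⟨hrw, e3, e4, d1, ?_⟩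
  obtain ⟨s1, rfl | ⟨rfl, h1, h3, hM, -⟩⟩ := hg
  · refine ⟨1, by norm_num, by norm_num, ?_⟩
    rw [Function.iterate_one, piMap_braid T e3, cs.simple_mul_simple_cancel_right]
    exact InCoset.refl.left
  · refine ⟨3, by norm_num, by norm_num, ?_⟩
    change InCoset cs _ _ _ (PiMap cs (PiMap cs (PiMap cs _)))
    rw [piMap_commute (descent_iff_of_pair h2 nyr h1 h3) hM, cs.simple_mul_simple_cancel_right,
      piMap_piMap_of_braid h2 hrw e3 hb.descent s1]
    · rw [cs.simple_mul_simple_cancel_right]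
      exact InCoset.refl.left.right
    · intro hc
      exact no_three_descents h2 nxr nxw nrw hb.descent s1 hc
    · intro z
      rw [cs.simple_mul_simple_cancel_right]
      exact ⟨no_other_descent_of_pair h2 nxw d1 d2 e4,
        by rintro rfl; exact descent_one d1 d2 nxw⟩

theorem piMap_mul_of_commute (hr : 𝒟 h r) (hw : 𝒟 h w) (hrw : M r w = 2) (hyw : M y w = 3)
    (hyr : 6 ≤ M y r) (hy : 𝒟 (h ⋆ w) y) : PiMap cs (h ⋆ r) = h ⋆ r ⋆ w := by
  have nrw : r ≠ w := entry_ne hrw (by norm_num)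
  have nyr : y ≠ r := by
    rintro rfl
    rw [M.diagonal] at hyr
    omega
  have hry : 6 ≤ M r y := by rwa [M.symmetric]
  have hwy : M w y = 3 := by rwa [M.symmetric]
  have d1 := descent_one hr hw nrw
  have d2 := descent_one hw hr nrw.symm
  refine piMap_single fun z => ⟨fun hz => ?_, by rintro rfl; exact d1⟩
  by_contra nzw
  have b := descent_one d1 hz (Ne.symm nzw)
  rw [commute hrw] at b
  have := no_other_descent_of_pair h2 nyr.symm d2 hy hry b
  subst this
  have := entries_eq_three (cs := cs) (h := h ⋆ r ⋆ w) (r := z) h2 nrw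
    (by rwa [commute hrw, descent_mul_self, not_not]) (by rwa [descent_mul_self, not_not])
    (by rwa [commute hrw, cs.simple_mul_simple_cancel_right])
    (by rwa [cs.simple_mul_simple_cancel_right]) (by omega) (by omega)
  omega

/-- Opposite sides, the first carrying a commuting label. -/
theorem iteratesMeet_of_commute (hr : 𝒟 h r) (hw : 𝒟 h w)
    (hg : PiMap cs g = h ⋆ r) (hM : M w r = 2) (hyw : M y w = 3) (hyr : 6 ≤ M y r)
    (hy : 𝒟 (h ⋆ w) y) {k : ℕ} (hk : 0 < k) (hk3 : k ≤ 3)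
    (hg' : InCoset cs (h ⋆ w) y r ((PiMap cs)^[k] g')) : IteratesMeet cs g g' := by
  have hrw : M r w = 2 := by rwa [M.symmetric]
  refine ⟨2, k, by norm_num, hk3, by omega, h ⋆ w, y, r, by omega, ?_, hg'⟩
  change InCoset cs _ _ _ (PiMap cs (PiMap cs g))
  rw [hg, piMap_mul_of_commute h2 hr hw hrw hyw hyr hy, commute hrw]
  exact InCoset.refl.right

theorem iteratesMeet_of_same_label (hb : IsBase cs h x y) (hr : 𝒟 h r) (hw : 𝒟 h w)
    (nrw : r ≠ w) (hg : IsShortSide cs h x y r g) (hg' : IsShortSide cs h y x r g') :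
    IteratesMeet cs g g' := by
  rcases hg.cases h2 hb hr hw nrw with ⟨m1, -, e1⟩ | ⟨m1, m2, m3, d, k, k1, k3, i1⟩ <;>
  rcases hg'.cases h2 hb.symm hr hw nrw with ⟨m1', -, e1'⟩ | ⟨m1', m2', m3', d', k', k1', k3', i1'⟩
  · exact (hb.entry (entry_eq_zero_of_commute h2 (a := r) hb.ne
      (by rwa [M.symmetric]) (by rwa [M.symmetric]))).elim
  · refine ⟨1, k', by norm_num, k3', by norm_num, _, y, w, by omega, ?_, i1'⟩
    rw [Function.iterate_one, e1]
    exact InCoset.refl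
  · refine ⟨k, 1, k3, by norm_num, by norm_num, _, x, w, by omega, i1, ?_⟩
    rw [Function.iterate_one, e1']
    exact InCoset.refl
  · exact (no_three_descents h2 hb.ne (hb.ne_left hw) (hb.symm.ne_left hw) d d'
      (descent_one hr hw nrw)).elim

theorem iteratesMeet_of_distinct_labels (hb : IsBase cs h x y) (hr : 𝒟 h r) (hw : 𝒟 h w)
    (nrw : r ≠ w) (hg : IsShortSide cs h x y r g) (hg' : IsShortSide cs h y x w g') :
    IteratesMeet cs g g' := by
  rcases hg.cases h2 hb hr hw nrw with ⟨m1, -, e1⟩ | ⟨m1, m2, m3, d, k, k1, k3, i1⟩ <;>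
  rcases hg'.cases h2 hb.symm hw hr nrw.symm with
    ⟨m1', -, e1'⟩ | ⟨m1', m2', m3', d', k', k1', k3', i1'⟩
  · refine .of_one (t := h) (entry_ne_zero hr hw) ?_ ?_
    · rw [e1]
      exact InCoset.refl.left
    · rw [e1']
      exact InCoset.refl.right
  · exact iteratesMeet_of_commute h2 hr hw e1 m1' m2' m3' d' k1' k3' i1'
  · exact (iteratesMeet_of_commute h2 hw hr e1' m1 m2 m3 d k1 k3 i1).symm
  · have b := descent_one (descent_one hr hw nrw) d (hb.ne_left hw).symm
    rw [commute m1] at b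
    have := no_other_descent_of_pair h2 (hb.symm.ne_left hr).symm
      (descent_one hw hr nrw.symm) d' (by rwa [M.symmetric]) b
    exact (hb.ne this).elim

theorem IsShortSide.iteratesMeet_base (hb : IsBase cs h x y) (hr : 𝒟 h r)
    (hg : IsShortSide cs h x y r g) : IteratesMeet cs h g := by
  have nxr := hb.ne_left hr
  have nyr := hb.symm.ne_left hr
  by_cases hs : ∃ w, w ≠ r ∧ 𝒟 h w
  · obtain ⟨w, nwr, hw⟩ := hs
    have T := descent_iff_of_pair h2 nwr.symm hr hw
    rcases hg.cases h2 hb hr hw nwr.symm with ⟨-, -, e⟩ | ⟨m1, -, m3, -, k, k1, k3, i1⟩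
    · refine .of_one (t := h) (entry_ne_zero hr hw) (piMap_mem_pair fun z hz => (T z).1 hz) ?_
      rw [e]
      exact InCoset.refl.left
    · refine ⟨1, k, by norm_num, k3, by norm_num, _, x, w, by omega, ?_, i1⟩
      rw [Function.iterate_one, piMap_commute T m1]
      exact InCoset.refl.right
  · push Not at hs
    refine .of_one (t := h ⋆ r) (entry_ne_zero hb.descent hg.1) ?_ (hg.piMap_mem h2 hb nxr nyr)
    rw [piMap_single fun z => ⟨fun hz => by_contra fun hne => hs z hne hz,
      by rintro rfl; exact hr⟩]
    exact InCoset.refl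

theorem iteratesMeet_of_same_side (hb : IsBase cs h x y) (hr : 𝒟 h r) (hw : 𝒟 h w)
    (hg : IsShortSide cs h x y r g) (hg' : IsShortSide cs h x y w g') : IteratesMeet cs g g' := by
  have nxr := hb.ne_left hr
  have nyr := hb.symm.ne_left hr
  obtain rfl : r = w := by
    by_contra nrw
    exact no_three_descents h2 nxr (hb.ne_left hw) nrw hb.descent hg.1 hg'.1
  exact .of_one (entry_ne_zero hb.descent hg.1) (hg.piMap_mem h2 hb nxr nyr)
    (hg'.piMap_mem h2 hb nxr nyr)

theorem iteratesMeet_of_opposite_sides (hb : IsBase cs h x y) (hr : 𝒟 h r) (hw : 𝒟 h w)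
    (hg : IsShortSide cs h x y r g) (hg' : IsShortSide cs h y x w g') : IteratesMeet cs g g' := by
  by_cases nrw : r = w
  · subst nrw
    by_cases hs : ∃ w, r ≠ w ∧ 𝒟 h w
    · obtain ⟨w, nrw, hw⟩ := hs
      exact iteratesMeet_of_same_label h2 hb hr hw nrw hg hg'
    · exact iteratesMeet_of_single h2 hb (hb.ne_left hr) (hb.symm.ne_left hr) hg hg'
  · exact iteratesMeet_of_distinct_labels h2 hb hr hw nrw hg hg'

theorem iteratesMeet_of_descents (hb : IsBase cs h x y) (hg : InCoset cs h x y g)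
    (hg' : InCoset cs h x y g') (hr : 𝒟 g r) (nxr : x ≠ r) (nyr : y ≠ r) (hw : 𝒟 g' w)
    (nxw : x ≠ w) (nyw : y ≠ w) : IteratesMeet cs g g' := by
  obtain ⟨hr', s⟩ := eq_or_isSide h2 hb hg hr nxr nyr
  obtain ⟨hw', s'⟩ := eq_or_isSide h2 hb hg' hw nxw nyw
  have six : ∀ {x y q}, IsBase cs h x y → InCoset cs h x y g → InCoset cs h x y g' → x ≠ r →
      y ≠ r → x ≠ w → y ≠ w → (𝒟 (h ⋆ x ⋆ y) y ∧ 𝒟 (h ⋆ x ⋆ y) q ∧ M x q = 2 ∧ M y q = 3 ∧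
      6 ≤ M x y) → IteratesMeet cs g g' := by
    rintro x y q hb hg hg' nxr nyr nxw nyw ⟨h1, h3, m1, m2, m3⟩
    obtain ⟨k, k1, k3, i1⟩ := iterate_mem_of_six_le h2 hb h1 h3 m1 m2 m3 hg hr nxr nyr
    obtain ⟨k', -, k3', i1'⟩ := iterate_mem_of_six_le h2 hb h1 h3 m1 m2 m3 hg' hw nxw nyw
    exact ⟨k, k', k3, k3', by omega, _, x, y, hb.entry, i1, i1'⟩
  have split : ∀ {x y q c}, IsBase cs h x y → InCoset cs h x y g → InCoset cs h x y g' → x ≠ r →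
      y ≠ r → x ≠ w → y ≠ w → 𝒟 h q → IsSide cs h x y q c →
      IsShortSide cs h x y q c ∨ IteratesMeet cs g g' :=
    fun hb hg hg' nxr nyr nxw nyw hq hc =>
      (hc.isShortSide_or h2 hb (hb.ne_left hq) (hb.symm.ne_left hq)).imp_right
        (six hb hg hg' nxr nyr nxw nyw)
  have s1 : (g = h ∨ IsShortSide cs h x y r g ∨ IsShortSide cs h y x r g) ∨
      IteratesMeet cs g g' := by
    rcases s with s | s | s
    · exact Or.inl (Or.inl s)
    · rcases split hb hg hg' nxr nyr nxw nyw hr' s with s | s <;> tauto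
    · rcases split hb.symm hg.swap hg'.swap nyr nxr nyw nxw hr' s with s | s <;> tauto
  have s1' : (g' = h ∨ IsShortSide cs h x y w g' ∨ IsShortSide cs h y x w g') ∨
      IteratesMeet cs g g' := by
    rcases s' with s | s | s
    · exact Or.inl (Or.inl s)
    · rcases split hb hg hg' nxr nyr nxw nyw hw' s with s | s <;> tauto
    · rcases split hb.symm hg.swap hg'.swap nyr nxr nyw nxw hw' s with s | s <;> tauto
  rcases s1 with s1 | s1
  swap
  · exact s1
  rcases s1' with s1' | s1'
  swap
  · exact s1'
  rcases s1 with rfl | s1 | s1 <;> rcases s1' with e | s1' | s1'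
  · subst e
    exact .of_one hb.entry .refl .refl
  · exact s1'.iteratesMeet_base h2 hb hw'
  · exact s1'.iteratesMeet_base h2 hb.symm hw'
  · subst e
    exact (s1.iteratesMeet_base h2 hb hr').symm
  · exact iteratesMeet_of_same_side h2 hb hr' hw' s1 s1'
  · exact iteratesMeet_of_opposite_sides h2 hb hr' hw' s1 s1'
  · subst e
    exact (s1.iteratesMeet_base h2 hb.symm hr').symm
  · exact iteratesMeet_of_opposite_sides h2 hb.symm hr' hw' s1 s1'
  · exact iteratesMeet_of_same_side h2 hb.symm hr' hw' s1 s1'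

end TwoDim

theorem iteratesMeet_of_forall_descent (h0 : M x y ≠ 0) (hg : InCoset cs h x y g)
    (hg' : InCoset cs h x y g') (hT : ∀ z, 𝒟 g z → z = x ∨ z = y) : IteratesMeet cs g g' :=
  ⟨1, 0, by norm_num, by norm_num, by norm_num, h, x, y, h0, hg.trans (piMap_mem_pair hT), hg'⟩

theorem iteratesMeet_of_mul [Finite B] (h2 : TwoDimensional cs) (hs : 𝒟 g s) :
    IteratesMeet cs g (g ⋆ s) := by
  by_cases hw : ∃ w, w ≠ s ∧ 𝒟 g w
  · obtain ⟨w, nws, hw⟩ := hw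
    exact iteratesMeet_of_forall_descent (h := g) (entry_ne_zero hs hw) .refl (.left .refl)
      fun z hz => (descent_iff_of_pair h2 nws.symm hs hw z).1 hz
  · push Not at hw
    refine iteratesMeet_of_forall_descent (h := g) (x := s) (y := s)
      (by rw [M.diagonal]; norm_num) .refl (.left .refl) fun z hz => Or.inl ?_
    exact by_contra fun hne => hw z hne hz

theorem iteratesMeet_of_inCoset [Finite B] (h2 : TwoDimensional cs) (h0 : M x y ≠ 0)
    (hg : InCoset cs g x y g') : IteratesMeet cs g g' := by
  by_cases nxy : x = y
  · subst nxy
    rcases InCoset.eq_or_eq hg with rfl | rfl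
    · exact .of_one h0 .refl .refl
    by_cases hx : 𝒟 g x
    · exact iteratesMeet_of_mul h2 hx
    · have := iteratesMeet_of_mul h2 (descent_mul_self.2 hx)
      rw [cs.simple_mul_simple_cancel_right] at this
      exact this.symm
  obtain ⟨h, hh, hd⟩ := exists_not_descent (cs := cs) {x, y} g
  have hb : IsBase cs h x y := ⟨nxy, h0, hd x (by simp), hd y (by simp)⟩
  have ig : InCoset cs h x y g := hh
  have ig' := ig.trans hg
  by_cases T : ∀ z, 𝒟 g z → z = x ∨ z = y
  · exact iteratesMeet_of_forall_descent h0 ig ig' T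
  by_cases T' : ∀ z, 𝒟 g' z → z = x ∨ z = y
  · exact (iteratesMeet_of_forall_descent h0 ig' ig T').symm
  push Not at T T'
  obtain ⟨r, hr, nrx, nry⟩ := T
  obtain ⟨w, hw, nwx, nwy⟩ := T'
  exact iteratesMeet_of_descents h2 hb ig ig' hr nrx.symm nry.symm hw nwx.symm nwy.symm

end Proof

end CoxeterPaper

namespace CoxeterPaper

open CoxeterSystem

attribute [local instance] Classical.propDecidable

variable {B : Type} [DecidableEq B] [Fintype B]
variable {W : Type} [Group W] {M : CoxeterMatrix B}

/-- **Proposition.** If `g' ∈ g⟨s,t⟩` with `m_st < ∞` (possibly `s = t`), then there are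
`0 ≤ k, k' ≤ 3` with `k + k' > 0` such that `Π^{k'}(g') ∈ Π^k(g)⟨p,r⟩` for some `p, r ∈ S`
with `m_pr < ∞` (possibly `p = r`). -/
theorem proposition_main
    (cs : CoxeterSystem M W) (h2 : TwoDimensional cs) (g g' : W) (i j : B)
    (hm : M.M i j ≠ 0)
    (hmem : g⁻¹ * g' ∈ Subgroup.closure {cs.simple i, cs.simple j}) :
    ∃ k k' : ℕ, k ≤ 3 ∧ k' ≤ 3 ∧ 0 < k + k' ∧
      ∃ p r : B, M.M p r ≠ 0 ∧
        ((PiMap cs)^[k] g)⁻¹ * (PiMap cs)^[k'] g' ∈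
          Subgroup.closure {cs.simple p, cs.simple r} := by
  have hg : InCoset cs g i j g' := by
    unfold InCoset parabolic
    rwa [Set.image_pair]
  obtain ⟨k, k', h3, h4, h5, t, p, r, h6, h7, h8⟩ := iteratesMeet_of_inCoset h2 hm hg
  refine ⟨k, k', h3, h4, h5, p, r, h6, ?_⟩
  have := h7.symm.trans h8
  unfold InCoset parabolic at this
  rwa [Set.image_pair] at this

end CoxeterPaper
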